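/- arXiv:2203.04652 — 2 statements merged into one kernel-verified Lean document; each statement's English description precedes it below -/
import Mathlib

section
/- Let r ≤ m and r ≤ n be positive integers and let G = K_m ⋆_r K_n. Then J_{overline(K_m ⋆_r K_n)} is strongly unmixed (in particular, overline(K_m ⋆_r K_n) is accessible and J_{overline(K_m ⋆_r K_n)} is unmixed). -/
open SimpleGraph

universe u u'

/-- The number of connected components of the induced subgraph of `G` on the vertex set `A`. -/
noncomputable def cComp {V : Type u} (G : SimpleGraph V) (A : Set V) : ℕ :=
  Nat.card (G.induce A).ConnectedComponent

/-- `x` is a cut vertex of the induced subgraph of `G` on `A`: removing `x`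
increases the number of connected components. -/
def CutVertexOn {V : Type u} (G : SimpleGraph V) (A : Set V) (x : V) : Prop :=
  x ∈ A ∧ cComp G A < cComp G (A \ {x})

/-- `T` is a cutset of the induced subgraph of `G` on `A`: every `t ∈ T` is a
cut vertex of `G[A] ∖ (T ∖ {t})`. -/
def CutsetOn {V : Type u} [DecidableEq V] (G : SimpleGraph V) (A : Set V) (T : Finset V) :
    Prop :=
  ↑T ⊆ A ∧ ∀ t ∈ T, CutVertexOn G (A \ ↑(T.erase t)) t

/-- The binomial edge ideal of the induced subgraph of `G` on `A` is unmixed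
(combinatorial characterization): `c(T) = |T| + c(∅)` for every cutset `T`. -/
def UnmixedOn {V : Type u} [DecidableEq V] (G : SimpleGraph V) (A : Set V) : Prop :=
  ∀ T : Finset V, CutsetOn G A T → cComp G (A \ ↑T) = T.card + cComp G A

/-- The induced subgraph of `G` on `A` is accessible. -/
def AccessibleOn {V : Type u} [DecidableEq V] (G : SimpleGraph V) (A : Set V) : Prop :=
  UnmixedOn G A ∧
    ∀ T : Finset V, CutsetOn G A T → T.Nonempty → ∃ t ∈ T, CutsetOn G A (T.erase t)

/-- The graph `(G[A])_x`: add all edges between neighbours of `x` lying in `A`. -/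
def cliqueAtOn {V : Type u} (G : SimpleGraph V) (A : Set V) (x : V) : SimpleGraph V :=
  G ⊔ SimpleGraph.fromRel (fun a b => a ∈ A ∧ b ∈ A ∧ G.Adj x a ∧ G.Adj x b)

/-- The binomial edge ideal of the induced subgraph of `G` on `A` is strongly unmixed. -/
inductive StronglyUnmixedOn {V : Type u} [DecidableEq V] : SimpleGraph V → Set V → Prop
  | complete (G : SimpleGraph V) (A : Set V)
      (h : ∀ a b : A, (G.induce A).Reachable a b → a ≠ b → (G.induce A).Adj a b) :
      StronglyUnmixedOn G A
  | cut (G : SimpleGraph V) (A : Set V) (hU : UnmixedOn G A) (x : V)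
      (hx : CutVertexOn G A x)
      (h1 : StronglyUnmixedOn G (A \ {x}))
      (h2 : StronglyUnmixedOn (cliqueAtOn G A x) A)
      (h3 : StronglyUnmixedOn (cliqueAtOn G A x) (A \ {x})) :
      StronglyUnmixedOn G A

/-- `x` is a free vertex of `G`: the induced subgraph on `N(x) ∪ {x}` is complete. -/
def FreeVertex {V : Type u} (G : SimpleGraph V) (x : V) : Prop :=
  ∀ a b : V, G.Adj x a → G.Adj x b → a ≠ b → G.Adj a b

/-- Attach a whisker (pendant vertex) at each vertex of `Wv`.  `Sum.inl a` is the
original vertex `a` and `Sum.inr x` is the whisker vertex `f_x` attached at `x ∈ Wv`. -/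
def whiskered {V : Type u} (G : SimpleGraph V) (Wv : Set V) : SimpleGraph (V ⊕ V) :=
  SimpleGraph.fromRel (fun a b =>
    (∃ x y, G.Adj x y ∧ a = Sum.inl x ∧ b = Sum.inl y) ∨
    (∃ x ∈ Wv, a = Sum.inl x ∧ b = Sum.inr x))

/-- `B` is (the vertex set of) a block of `G`: a maximal connected induced
subgraph having no cut vertex. -/
def IsBlock {V : Type u} (G : SimpleGraph V) (B : Set V) : Prop :=
  (G.induce B).Connected ∧ (∀ x, ¬ CutVertexOn G B x) ∧
    ∀ B' : Set V, B ⊆ B' → (G.induce B').Connected → (∀ x, ¬ CutVertexOn G B' x) → B' = B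

/-- Glue two graphs `G` and `H`, identifying the vertex `x` of `G` with the vertex
`y` of `H` (the identified vertex is `Sum.inl x`). -/
def glueAt {V : Type u} {W : Type u'} (G : SimpleGraph V) (H : SimpleGraph W) (x : V) (y : W) :
    SimpleGraph (V ⊕ W) :=
  SimpleGraph.fromRel (fun a b =>
    (∃ p q, G.Adj p q ∧ a = Sum.inl p ∧ b = Sum.inl q) ∨
    (∃ p q, H.Adj p q ∧ p ≠ y ∧ q ≠ y ∧ a = Sum.inr p ∧ b = Sum.inr q) ∨
    (∃ q, H.Adj y q ∧ a = Sum.inl x ∧ b = Sum.inr q))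

/-- The star product `K_m ⋆_r K_n`: two complete graphs, on `{x₁,…,x_m}` (the `inl`s)
and `{y₁,…,y_n}` (the `inr`s), together with the matching edges `{x_i, y_i}` for `1 ≤ i ≤ r`
(indices `0,…,r-1` here). -/
def starProd (m n r : ℕ) : SimpleGraph (Fin m ⊕ Fin n) :=
  SimpleGraph.fromRel (fun a b =>
    (∃ x y : Fin m, a = Sum.inl x ∧ b = Sum.inl y) ∨
    (∃ x y : Fin n, a = Sum.inr x ∧ b = Sum.inr y) ∨
    (∃ (x : Fin m) (y : Fin n), (x : ℕ) = (y : ℕ) ∧ (x : ℕ) < r ∧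
      a = Sum.inl x ∧ b = Sum.inr y))

/-- The vertices `x_i, y_i` for `2 ≤ i ≤ r` (indices `1,…,r-1` here), at which
whiskers are attached to form `overline(K_m ⋆_r K_n)`. -/
def starWhisk (m n r : ℕ) : Set (Fin m ⊕ Fin n) :=
  {a | (∃ x : Fin m, a = Sum.inl x ∧ 1 ≤ (x : ℕ) ∧ (x : ℕ) < r) ∨
       (∃ y : Fin n, a = Sum.inr y ∧ 1 ≤ (y : ℕ) ∧ (y : ℕ) < r)}

/-- `a` and `b` both lie in `A` and are joined by a path of the induced subgraph of `G` on `A`. -/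
def ReachIn {V : Type u} (G : SimpleGraph V) (A : Set V) (a b : V) : Prop :=
  ∃ (ha : a ∈ A) (hb : b ∈ A), (G.induce A).Reachable ⟨a, ha⟩ ⟨b, hb⟩

/-- Auxiliary (connected case): `G[A]` has no cut vertex, or for every cut vertex `x`,
every connected component of `G[A] ∖ {x}` contains at most `r` cut vertices of `G[A] ∖ {x}`. -/
def RCutConnAux {V : Type u} (G : SimpleGraph V) (A : Set V) (r : ℕ) : Prop :=
  (∀ x, ¬ CutVertexOn G A x) ∨
    ∀ x, CutVertexOn G A x → ∀ a ∈ A \ {x},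
      Set.ncard {w | CutVertexOn G (A \ {x}) w ∧ ReachIn G (A \ {x}) a w} ≤ r

/-- `G[A]` is `r`-cut-connected: every connected component of `G[A]` satisfies the
condition of `RCutConnAux`. -/
def RCutConn {V : Type u} (G : SimpleGraph V) (A : Set V) (r : ℕ) : Prop :=
  ∀ a ∈ A, RCutConnAux G {b | ReachIn G A a b} r

/-- `G[A]` is strongly `r`-cut-connected: it is `r`-cut-connected and, recursively,
`G[A] ∖ {x}` is strongly `r`-cut-connected for every cut vertex `x`. -/
inductive StronglyRCutConn {V : Type u} (r : ℕ) : SimpleGraph V → Set V → Prop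
  | mk (G : SimpleGraph V) (A : Set V) (h1 : RCutConn G A r)
      (h2 : ∀ x, CutVertexOn G A x → StronglyRCutConn r G (A \ {x})) :
      StronglyRCutConn r G A

section Components

variable {V : Type u} {G H : SimpleGraph V} {A B : Set V} {v : V}

theorem ReachIn.refl {a : V} (ha : a ∈ A) : ReachIn G A a a :=
  ⟨ha, ha, .rfl⟩

theorem ReachIn.symm {a b : V} (h : ReachIn G A a b) : ReachIn G A b a :=
  ⟨h.2.1, h.1, h.2.2.symm⟩

theorem ReachIn.trans {a b c : V} (h : ReachIn G A a b) (h' : ReachIn G A b c) :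
    ReachIn G A a c :=
  ⟨h.1, h'.2.1, h.2.2.trans h'.2.2⟩

theorem SimpleGraph.Adj.reachIn {a b : V} (h : G.Adj a b) (ha : a ∈ A) (hb : b ∈ A) :
    ReachIn G A a b :=
  ⟨ha, hb, SimpleGraph.Adj.reachable (G := G.induce A) (by exact h)⟩

theorem ReachIn.mono {a b : V} (hAB : A ⊆ B) (h : ReachIn G A a b) : ReachIn G B a b :=
  ⟨hAB h.1, hAB h.2.1, h.2.2.map (G.induceHomOfLE hAB).toHom⟩

/-- Induction along a path of `G[A]` ending at `b`. -/
theorem ReachIn.head_induction {b : V} {P : V → Prop} (hb : P b)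
    (step : ∀ a c, a ∈ A → c ∈ A → G.Adj a c → P c → P a) {a : V} (h : ReachIn G A a b) :
    P a := by
  obtain ⟨ha, hbA, ⟨w⟩⟩ := h
  have key : ∀ (x y : A), (G.induce A).Walk x y → P y → P x := by
    intro x y w
    induction w with
    | nil => exact id
    | @cons x z y hxz _ ih => exact fun hy => step x z x.2 z.2 hxz (ih hy)
  exact key _ _ w hb

/-- Connectivity in `G[A]` passes either outside of `v` or through neighbours of `v`. -/
theorem ReachIn.avoid_or {a b : V} (h : ReachIn G A a b) (ha : a ≠ v) (hb : b ≠ v) :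
    ReachIn G (A \ {v}) a b ∨
      ((∃ p, G.Adj v p ∧ ReachIn G (A \ {v}) a p) ∧
        ∃ q, G.Adj v q ∧ ReachIn G (A \ {v}) b q) := by
  have hbA : b ∈ A \ {v} := ⟨h.2.1, hb⟩
  have key : (a = v ∧ ∃ q, G.Adj v q ∧ ReachIn G (A \ {v}) b q) ∨ (a ≠ v ∧
      (ReachIn G (A \ {v}) a b ∨
      ((∃ p, G.Adj v p ∧ ReachIn G (A \ {v}) a p) ∧
        ∃ q, G.Adj v q ∧ ReachIn G (A \ {v}) b q))) := by
    refine ReachIn.head_induction (A := A) (G := G) (b := b)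
      (P := fun a => (a = v ∧ ∃ q, G.Adj v q ∧ ReachIn G (A \ {v}) b q) ∨ (a ≠ v ∧
      (ReachIn G (A \ {v}) a b ∨
      ((∃ p, G.Adj v p ∧ ReachIn G (A \ {v}) a p) ∧
        ∃ q, G.Adj v q ∧ ReachIn G (A \ {v}) b q)))) (.inr ⟨hb, .inl (.refl hbA)⟩) ?_ h
    rintro a c haA hcA hac (⟨rfl, hq⟩ | ⟨hcv, hc⟩)
    · exact .inr ⟨hac.ne, .inr ⟨⟨a, hac.symm, .refl ⟨haA, hac.ne⟩⟩, hq⟩⟩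
    · by_cases hav : a = v
      · subst hav
        refine .inl ⟨rfl, ?_⟩
        rcases hc with hc | hc
        · exact ⟨c, hac, hc.symm⟩
        · exact hc.2
      · have hr : ReachIn G (A \ {v}) a c := hac.reachIn ⟨haA, hav⟩ ⟨hcA, hcv⟩
        refine .inr ⟨hav, ?_⟩
        rcases hc with hc | ⟨⟨p, hp, hcp⟩, hq⟩
        · exact .inl (hr.trans hc)
        · exact .inr ⟨⟨p, hp, hr.trans hcp⟩, hq⟩
  rcases key with ⟨h', _⟩ | ⟨_, h'⟩
  · exact absurd h' ha
  · exact h'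

/-- The map on connected components induced by the inclusion of `G[A ∖ {v}]` in `G[A]`. -/
noncomputable def compMap (G : SimpleGraph V) (A : Set V) (v : V) :
    (G.induce (A \ {v})).ConnectedComponent → (G.induce A).ConnectedComponent :=
  ConnectedComponent.map (G.induceHomOfLE Set.sdiff_subset).toHom

theorem reachIn_of_compMap_eq {a b : ↥(A \ {v})}
    (h : compMap G A v ((G.induce (A \ {v})).connectedComponentMk a) =
      compMap G A v ((G.induce (A \ {v})).connectedComponentMk b)) : ReachIn G A a b :=
  ⟨a.2.1, b.2.1, ConnectedComponent.exact h⟩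

theorem compMk_eq_of_reachIn {a b : ↥A} (h : ReachIn G A a b) :
    (G.induce A).connectedComponentMk a = (G.induce A).connectedComponentMk b :=
  ConnectedComponent.sound h.2.2

theorem cComp_diff_le [Finite V]
    (h : ∀ p q, G.Adj v p → G.Adj v q → p ∈ A \ {v} → q ∈ A \ {v} →
      ReachIn G (A \ {v}) p q) : cComp G (A \ {v}) ≤ cComp G A := by
  refine Nat.card_le_card_of_injective (compMap G A v) ?_
  intro C D
  induction C using ConnectedComponent.ind with | _ a
  induction D using ConnectedComponent.ind with | _ b
  intro hab
  apply compMk_eq_of_reachIn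
  rcases (reachIn_of_compMap_eq hab).avoid_or a.2.2 b.2.2 with h' | ⟨⟨p, hp, hap⟩, q, hq, hbq⟩
  · exact h'
  · exact hap.trans ((h p q hp hq hap.2.1 hbq.2.1).trans hbq.symm)

theorem cComp_diff_le_succ [Finite V] (C : Set V)
    (h : ∀ p q, G.Adj v p → G.Adj v q → p ∈ A \ {v} → q ∈ A \ {v} → (p ∈ C ↔ q ∈ C) →
      ReachIn G (A \ {v}) p q) : cComp G (A \ {v}) ≤ cComp G A + 1 := by
  classical
  unfold cComp
  rw [← Finite.card_option]
  let f : (G.induce (A \ {v})).ConnectedComponent → Option (G.induce A).ConnectedComponent :=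
    fun D => if ∃ p : ↥(A \ {v}), G.Adj v p ∧ (p : V) ∈ C ∧
      D = (G.induce (A \ {v})).connectedComponentMk p then none else some (compMap G A v D)
  refine Nat.card_le_card_of_injective f ?_
  intro D E hDE
  by_cases hD : ∃ p : ↥(A \ {v}), G.Adj v p ∧ (p : V) ∈ C ∧
      D = (G.induce (A \ {v})).connectedComponentMk p <;>
  by_cases hE : ∃ p : ↥(A \ {v}), G.Adj v p ∧ (p : V) ∈ C ∧
      E = (G.induce (A \ {v})).connectedComponentMk p
  · obtain ⟨p, hp, hpC, rfl⟩ := hD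
    obtain ⟨q, hq, hqC, rfl⟩ := hE
    exact compMk_eq_of_reachIn (h p q hp hq p.2 q.2 (iff_of_true hpC hqC))
  · simp only [f, if_pos hD, if_neg hE] at hDE
    cases hDE
  · simp only [f, if_neg hD, if_pos hE] at hDE
    cases hDE
  · simp only [f, if_neg hD, if_neg hE, Option.some.injEq] at hDE
    induction D using ConnectedComponent.ind with | _ a
    induction E using ConnectedComponent.ind with | _ b
    apply compMk_eq_of_reachIn
    rcases (reachIn_of_compMap_eq hDE).avoid_or a.2.2 b.2.2 with
      h' | ⟨⟨p, hp, hap⟩, q, hq, hbq⟩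
    · exact h'
    · have hpC : p ∉ C := fun hpC => hD ⟨⟨p, hap.2.1⟩, hp, hpC, compMk_eq_of_reachIn hap⟩
      have hqC : q ∉ C := fun hqC => hE ⟨⟨q, hbq.2.1⟩, hq, hqC, compMk_eq_of_reachIn hbq⟩
      exact hap.trans ((h p q hp hq hap.2.1 hbq.2.1 (iff_of_false hpC hqC)).trans hbq.symm)

theorem cComp_lt_diff [Finite V] {p q : V} (hv : v ∈ A) (hp : G.Adj v p) (hq : G.Adj v q)
    (hpA : p ∈ A) (hqA : q ∈ A) (h : ¬ ReachIn G (A \ {v}) p q) :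
    cComp G A < cComp G (A \ {v}) := by
  have hpA' : p ∈ A \ {v} := ⟨hpA, hp.ne'⟩
  have hqA' : q ∈ A \ {v} := ⟨hqA, hq.ne'⟩
  have hsurj : Function.Surjective (compMap G A v) := by
    intro D
    induction D using ConnectedComponent.ind with | _ a
    by_cases ha : (a : V) = v
    · exact ⟨(G.induce (A \ {v})).connectedComponentMk ⟨p, hpA'⟩,
        compMk_eq_of_reachIn (a := ⟨p, hpA⟩)
          (SimpleGraph.Adj.reachIn (ha ▸ hp.symm : G.Adj p a) hpA a.2)⟩
    · exact ⟨(G.induce (A \ {v})).connectedComponentMk ⟨a, a.2, ha⟩, rfl⟩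
  by_contra! hle
  have hinj := (hsurj.bijective_of_nat_card_le hle).1
  refine h ⟨hpA', hqA', ConnectedComponent.exact (hinj ?_)⟩
  exact compMk_eq_of_reachIn (a := ⟨p, hpA⟩) (b := ⟨q, hqA⟩)
    ((hp.symm.reachIn hpA hv).trans (hq.reachIn hv hqA))

/-- `G` and `H` induce the same graph on `A`. -/
def AgreeOn (G H : SimpleGraph V) (A : Set V) : Prop :=
  ∀ a ∈ A, ∀ b ∈ A, G.Adj a b ↔ H.Adj a b

theorem AgreeOn.mono (h : AgreeOn G H A) (hBA : B ⊆ A) : AgreeOn G H B :=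
  fun a ha b hb => h a (hBA ha) b (hBA hb)

theorem AgreeOn.induce_eq (h : AgreeOn G H A) : G.induce A = H.induce A := by
  ext a b
  exact h a a.2 b b.2

theorem AgreeOn.cComp_eq (h : AgreeOn G H A) : cComp G A = cComp H A := by
  unfold cComp
  rw [h.induce_eq]

theorem AgreeOn.cutVertexOn_iff (h : AgreeOn G H A) (x : V) :
    CutVertexOn G A x ↔ CutVertexOn H A x := by
  unfold CutVertexOn
  rw [h.cComp_eq, (h.mono Set.sdiff_subset).cComp_eq]

theorem AgreeOn.unmixedOn [DecidableEq V] (h : AgreeOn G H A) (hU : UnmixedOn G A) :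
    UnmixedOn H A := by
  intro T hT
  rw [← h.cComp_eq, ← (h.mono Set.sdiff_subset).cComp_eq]
  exact hU T ⟨hT.1, fun t ht => ((h.mono Set.sdiff_subset).cutVertexOn_iff t).2 (hT.2 t ht)⟩

theorem AgreeOn.cliqueAtOn (h : AgreeOn G H A) {x : V} (hx : x ∈ A) :
    AgreeOn (cliqueAtOn G A x) (cliqueAtOn H A x) A := by
  intro a ha b hb
  simp only [_root_.cliqueAtOn, SimpleGraph.sup_adj, SimpleGraph.fromRel_adj, h a ha b hb,
    h x hx a ha, h x hx b hb]

theorem StronglyUnmixedOn.congr [DecidableEq V] (hG : StronglyUnmixedOn G A)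
    (h : AgreeOn G H A) : StronglyUnmixedOn H A := by
  induction hG generalizing H with
  | complete G A hc =>
    refine .complete H A ?_
    rw [← h.induce_eq]
    exact hc
  | cut G A hU x hx _ _ _ ih1 ih2 ih3 =>
    have hA := h.cliqueAtOn hx.1
    exact .cut H A (h.unmixedOn hU) x ((h.cutVertexOn_iff x).1 hx)
      (ih1 (h.mono Set.sdiff_subset)) (ih2 hA) (ih3 (hA.mono Set.sdiff_subset))

/-- Every connected component of `G[A]` is complete. -/
def CompleteOn (G : SimpleGraph V) (A : Set V) : Prop :=
  ∀ a b, ReachIn G A a b → a ≠ b → G.Adj a b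

theorem CompleteOn.stronglyUnmixedOn [DecidableEq V] (h : CompleteOn G A) :
    StronglyUnmixedOn G A :=
  .complete G A fun a b hab hne => h a b ⟨a.2, b.2, hab⟩ (Subtype.coe_injective.ne hne)

/-- If `G[A ∖ {x}]` has complete components, then `x` is a cut vertex or a free vertex. -/
theorem StronglyUnmixedOn.of_completeOn_diff [Finite V] [DecidableEq V] {x : V} (hx : x ∈ A)
    (hU : UnmixedOn G A) (h1 : CompleteOn G (A \ {x}))
    (h2 : StronglyUnmixedOn (cliqueAtOn G A x) A)
    (h3 : StronglyUnmixedOn (cliqueAtOn G A x) (A \ {x})) : StronglyUnmixedOn G A := by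
  by_cases hcut : CutVertexOn G A x
  · exact .cut G A hU x hcut h1.stronglyUnmixedOn h2 h3
  · refine h2.congr fun a ha b hb => ?_
    have key : ∀ a b, a ≠ b → a ∈ A → b ∈ A → G.Adj x a → G.Adj x b → G.Adj a b := by
      intro a b hab ha hb hxa hxb
      by_contra hadj
      exact hcut ⟨hx, cComp_lt_diff hx hxa hxb ha hb fun hr => hadj (h1 a b hr hab)⟩
    simp only [cliqueAtOn, SimpleGraph.sup_adj, SimpleGraph.fromRel_adj]
    constructor
    · rintro (h | ⟨hab, h | h⟩)
      · exact h
      · exact key a b hab ha hb h.2.2.1 h.2.2.2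
      · exact key a b hab ha hb h.2.2.2 h.2.2.1
    · exact .inl

end Components

section Bypass

variable {V : Type u} {G : SimpleGraph V} {S : Set V}

/-- `a` and `b` are the ends of a nontrivial walk of `G` whose inner vertices lie in `S`. -/
inductive LinkedVia (G : SimpleGraph V) (S : Set V) : V → V → Prop
  | adj {a b : V} (h : G.Adj a b) : LinkedVia G S a b
  | trans {a s b : V} (hs : s ∈ S) (h : LinkedVia G S a s) (h' : LinkedVia G S s b) :
      LinkedVia G S a b

theorem LinkedVia.symm {a b : V} (h : LinkedVia G S a b) : LinkedVia G S b a := by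
  induction h with
  | adj h => exact .adj h.symm
  | trans hs _ _ ih ih' => exact .trans hs ih' ih

theorem LinkedVia.exists_adj {a b : V} (h : LinkedVia G S a b) :
    ∃ p, G.Adj a p ∧ (p = b ∨ p ∈ S ∧ LinkedVia G S p b) := by
  induction h with
  | @adj a b h => exact ⟨b, h, .inl rfl⟩
  | trans hs _ h' ih _ =>
    obtain ⟨p, hp, rfl | ⟨hpS, h⟩⟩ := ih
    · exact ⟨p, hp, .inr ⟨hs, h'⟩⟩
    · exact ⟨p, hp, .inr ⟨hpS, .trans hs h h'⟩⟩

theorem LinkedVia.mono {T : Set V} (hST : S ⊆ T) {a b : V} (h : LinkedVia G S a b) :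
    LinkedVia G T a b := by
  induction h with
  | adj h => exact .adj h
  | trans hs _ _ ih ih' => exact .trans (hST hs) ih ih'

theorem LinkedVia.of_insert {v a b : V} (h : LinkedVia G (insert v S) a b) :
    LinkedVia G S a b ∨ (LinkedVia G S a v ∧ LinkedVia G S v b) := by
  induction h with
  | adj h => exact .inl (.adj h)
  | trans hs _ _ ih ih' =>
    rcases hs with rfl | hs
    · exact .inr ⟨ih.elim id (·.1), ih'.elim id (·.2)⟩
    · rcases ih with ih | ih <;> rcases ih' with ih' | ih'
      · exact .inl (.trans hs ih ih')
      · exact .inr ⟨.trans hs ih ih'.1, ih'.2⟩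
      · exact .inr ⟨ih.1, .trans hs ih.2 ih'⟩
      · exact .inr ⟨ih.1, ih'.2⟩

/-- The graph joining distinct vertices that are the ends of a walk of `G` with inner vertices
in `S`; it is obtained from `G` by iterating `cliqueAtOn` over `S`. -/
def bypass (G : SimpleGraph V) (S : Set V) : SimpleGraph V where
  Adj a b := a ≠ b ∧ LinkedVia G S a b
  symm := ⟨fun _ _ h => ⟨h.1.symm, h.2.symm⟩⟩
  loopless := ⟨fun _ h => h.1 rfl⟩

theorem SimpleGraph.Adj.bypass {a b : V} (h : G.Adj a b) : (bypass G S).Adj a b :=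
  ⟨h.ne, .adj h⟩

theorem bypass_empty : bypass G ∅ = G := by
  ext a b
  refine ⟨fun ⟨_, h⟩ => ?_, fun h => h.bypass⟩
  obtain ⟨p, hp, rfl | ⟨h, _⟩⟩ := h.exists_adj
  · exact hp
  · exact h.elim

theorem agreeOn_bypass_insert (A : Set V) (v : V) :
    AgreeOn (bypass G (insert v S)) (cliqueAtOn (bypass G S) A v) A := by
  intro a ha b hb
  simp only [cliqueAtOn, SimpleGraph.sup_adj, SimpleGraph.fromRel_adj]
  have hS : S ⊆ insert v S := Set.subset_insert v S
  have hv : v ∈ insert v S := Set.mem_insert v S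
  constructor
  · rintro ⟨hab, h⟩
    rcases h.of_insert with h | ⟨h, h'⟩
    · exact .inl ⟨hab, h⟩
    · by_cases hav : a = v
      · subst hav
        exact .inl ⟨hab, h'⟩
      · by_cases hbv : b = v
        · subst hbv
          exact .inl ⟨hab, h⟩
        · exact .inr ⟨hab, .inl ⟨ha, hb, ⟨Ne.symm hav, h.symm⟩, Ne.symm hbv, h'⟩⟩
  · rintro (h | ⟨hab, h | h⟩)
    · exact ⟨h.1, h.2.mono hS⟩
    · exact ⟨hab, .trans hv (h.2.2.1.2.symm.mono hS) (h.2.2.2.2.mono hS)⟩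
    · exact ⟨hab, .trans hv (h.2.2.2.2.symm.mono hS) (h.2.2.1.2.mono hS)⟩

/-- The neighbours of `v` in `G` that lie in `B` form a clique. -/
def FreeOn (G : SimpleGraph V) (B : Set V) (v : V) : Prop :=
  ∀ p ∈ B, ∀ q ∈ B, G.Adj v p → G.Adj v q → p ≠ q → G.Adj p q

theorem FreeVertex.freeOn {v : V} (h : FreeVertex G v) (B : Set V) : FreeOn G B v :=
  fun p _ q _ hp hq => h p q hp hq

/-- Walks from `a` and `b` arriving at adjacent or equal inner vertices can be concatenated. -/
theorem bypass_adj_of_links {a b p q : V} (hab : a ≠ b)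
    (hp : p = a ∨ p ∈ S ∧ LinkedVia G S p a) (hq : q = b ∨ q ∈ S ∧ LinkedVia G S q b)
    (hpq : p ≠ q → G.Adj p q) : (bypass G S).Adj a b := by
  refine ⟨hab, ?_⟩
  by_cases h : p = q
  · subst h
    rcases hp with rfl | ⟨hp, hpa⟩ <;> rcases hq with rfl | ⟨hq, hqb⟩
    · exact absurd rfl hab
    · exact hqb
    · exact hpa.symm
    · exact .trans hp hpa.symm hqb
  · have h' := LinkedVia.adj (S := S) (hpq h)
    rcases hp with rfl | ⟨hp, hpa⟩ <;> rcases hq with rfl | ⟨hq, hqb⟩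
    · exact h'
    · exact .trans hq h' hqb
    · exact .trans hp hpa.symm h'
    · exact .trans hp hpa.symm (.trans hq h' hqb)

theorem FreeOn.bypass {B : Set V} {v : V} (h : v ∈ S ∨ FreeOn G (B ∪ S) v) :
    FreeOn (bypass G S) B v := by
  intro a ha b hb hva hvb hab
  rcases h with h | h
  · exact ⟨hab, .trans h hva.2.symm hvb.2⟩
  · obtain ⟨p, hvp, hp⟩ := hva.2.exists_adj
    obtain ⟨q, hvq, hq⟩ := hvb.2.exists_adj
    have hpB : p ∈ B ∪ S := hp.elim (fun e => .inl (e ▸ ha)) fun h => .inr h.1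
    have hqB : q ∈ B ∪ S := hq.elim (fun e => .inl (e ▸ hb)) fun h => .inr h.1
    exact bypass_adj_of_links hab hp hq (h p hpB q hqB hvp hvq)

theorem completeOn_of_freeOn {H : SimpleGraph V} {A : Set V} (h : ∀ v ∈ A, FreeOn H A v) :
    CompleteOn H A := by
  intro a b hab
  refine ReachIn.head_induction (G := H) (A := A) (b := b) (P := fun a => a ≠ b → H.Adj a b)
    (fun h => absurd rfl h) ?_ hab
  intro a c ha hc hac ih hne
  by_cases hcb : c = b
  · exact hcb ▸ hac
  · exact h c hc a ha b hab.2.1 hac.symm (ih hcb) hne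

theorem FreeOn.not_cutVertexOn [Finite V] {H : SimpleGraph V} {A : Set V} {v : V}
    (h : FreeOn H A v) : ¬ CutVertexOn H A v := by
  rintro ⟨_, hlt⟩
  refine hlt.not_ge (cComp_diff_le fun p q hp hq hpA hqA => ?_)
  by_cases hpq : p = q
  · exact hpq ▸ .refl hpA
  · exact (h p hpA.1 q hqA.1 hp hq hpq).reachIn hpA hqA

/-- If the neighbours of `v` in `G` are a clique and a single vertex, then removing `v` creates
at most one new component. -/
theorem cComp_bypass_diff_le_succ [Finite V] {K : Set V} {v u : V}
    (hK : ∀ a ∈ K, ∀ b ∈ K, a ≠ b → G.Adj a b) (hv : ∀ p, G.Adj v p → p ∈ K ∨ p = u)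
    (A : Set V) : cComp (bypass G S) (A \ {v}) ≤ cComp (bypass G S) A + 1 := by
  refine cComp_diff_le_succ
    {a | ∃ p ∈ K, G.Adj v p ∧ (p = a ∨ p ∈ S ∧ LinkedVia G S p a)} ?_
  intro a b hva hvb ha hb hab
  by_cases hne : a = b
  · exact hne ▸ .refl ha
  refine SimpleGraph.Adj.reachIn ?_ ha hb
  by_cases haC : ∃ p ∈ K, G.Adj v p ∧ (p = a ∨ p ∈ S ∧ LinkedVia G S p a)
  · obtain ⟨q, hqK, _, hq⟩ := hab.1 haC
    obtain ⟨p, hpK, _, hp⟩ := haC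
    exact bypass_adj_of_links hne hp hq (hK p hpK q hqK)
  · have hbC := fun h => haC (hab.2 h)
    obtain ⟨p, hvp, hp⟩ := hva.2.exists_adj
    obtain ⟨q, hvq, hq⟩ := hvb.2.exists_adj
    have hpu : p = u := (hv p hvp).resolve_left fun h => haC ⟨p, h, hvp, hp⟩
    have hqu : q = u := (hv q hvq).resolve_left fun h => hbC ⟨q, h, hvq, hq⟩
    exact bypass_adj_of_links hne hp hq fun h => absurd (hpu.trans hqu.symm) h

end Bypass

section StarLike

variable {V : Type u} {G : SimpleGraph V} {A W X Y : Set V} {x₀ y₀ : V} {leaf : V → V}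

/-- Two cliques `X` and `Y` joined by the edge `x₀y₀`, and possibly by further edges between
vertices of `W`; each `w ∈ W` carries the whisker `leaf w`. -/
structure StarLike (G : SimpleGraph V) (A W X Y : Set V) (x₀ y₀ : V) (leaf : V → V) : Prop where
  x_mem : x₀ ∈ X
  y_mem : y₀ ∈ Y
  clique_x : ∀ a ∈ X, ∀ b ∈ X, a ≠ b → G.Adj a b
  clique_y : ∀ a ∈ Y, ∀ b ∈ Y, a ≠ b → G.Adj a b
  adj : G.Adj x₀ y₀
  subset_x : X ⊆ A
  subset_y : Y ⊆ A
  x_notMem : x₀ ∉ W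
  y_notMem : y₀ ∉ W
  mem_or_of_mem : ∀ w ∈ W, w ∈ X ∨ w ∈ Y
  leaf_mem : ∀ w ∈ W, leaf w ∈ A
  leaf_adj : ∀ w ∈ W, ∀ b, G.Adj (leaf w) b ↔ b = w
  leaf_notMem_x : ∀ w ∈ W, leaf w ∉ X
  leaf_notMem_y : ∀ w ∈ W, leaf w ∉ Y
  nbr_x : ∀ p, G.Adj x₀ p → p ∈ X ∨ p = y₀
  nbr_y : ∀ p, G.Adj y₀ p → p ∈ Y ∨ p = x₀
  cover : ∀ v ∈ A, v ∈ X ∨ v ∈ Y ∨ ∃ w ∈ W, v = leaf w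
  free : ∀ v ∈ A, v ∉ W → v ≠ x₀ → v ≠ y₀ → FreeVertex G v

namespace StarLike

theorem symm (h : StarLike G A W X Y x₀ y₀ leaf) : StarLike G A W Y X y₀ x₀ leaf where
  x_mem := h.y_mem
  y_mem := h.x_mem
  clique_x := h.clique_y
  clique_y := h.clique_x
  adj := h.adj.symm
  subset_x := h.subset_y
  subset_y := h.subset_x
  x_notMem := h.y_notMem
  y_notMem := h.x_notMem
  mem_or_of_mem := fun w hw => (h.mem_or_of_mem w hw).symm
  leaf_mem := h.leaf_mem
  leaf_adj := h.leaf_adj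
  leaf_notMem_x := h.leaf_notMem_y
  leaf_notMem_y := h.leaf_notMem_x
  nbr_x := h.nbr_y
  nbr_y := h.nbr_x
  cover := fun v hv => by
    rcases h.cover v hv with h | h | h
    · exact .inr (.inl h)
    · exact .inl h
    · exact .inr (.inr h)
  free := fun v hv hW hy hx => h.free v hv hW hx hy

variable {S D : Set V}

theorem reachIn_x_of_mem_x (h : StarLike G A W X Y x₀ y₀ leaf)
    (hD : D ⊆ W) {a : V} (ha : a ∈ X) (haD : a ∉ D) :
    ReachIn (bypass G S) (A \ D) a x₀ := by
  have hx : x₀ ∈ A \ D := ⟨h.subset_x h.x_mem, fun hx => h.x_notMem (hD hx)⟩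
  by_cases hax : a = x₀
  · subst hax
    exact .refl hx
  · exact (h.clique_x a ha x₀ h.x_mem hax).bypass.reachIn ⟨h.subset_x ha, haD⟩ hx

theorem reachIn_x (h : StarLike G A W X Y x₀ y₀ leaf)
    (hD : D ⊆ W) {a : V} (ha : a ∈ X ∨ a ∈ Y) (haD : a ∉ D) :
    ReachIn (bypass G S) (A \ D) a x₀ := by
  rcases ha with ha | ha
  · exact h.reachIn_x_of_mem_x hD ha haD
  · exact (h.symm.reachIn_x_of_mem_x hD ha haD).trans <| h.adj.symm.bypass.reachIn
      ⟨h.subset_y h.y_mem, fun hy => h.y_notMem (hD hy)⟩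
      ⟨h.subset_x h.x_mem, fun hx => h.x_notMem (hD hx)⟩

theorem reachIn_x_of_adj (h : StarLike G A W X Y x₀ y₀ leaf)
    (hD : D ⊆ W) {v a : V} (hva : (bypass G S).Adj v a)
    (ha : a ∈ A \ D) (hav : a ≠ leaf v) : ReachIn (bypass G S) (A \ D) a x₀ := by
  rcases h.cover a ha.1 with haX | haY | ⟨w, hw, rfl⟩
  · exact h.reachIn_x hD (.inl haX) ha.2
  · exact h.reachIn_x hD (.inr haY) ha.2
  · obtain ⟨p, hp, hpv⟩ := hva.2.symm.exists_adj
    rw [h.leaf_adj w hw] at hp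
    subst hp
    obtain ⟨hpS, _⟩ := hpv.resolve_left fun e => hav (e ▸ rfl)
    have hlp : LinkedVia G S (leaf p) p := .adj ((h.leaf_adj p hw p).2 rfl)
    rcases h.mem_or_of_mem p hw with hpX | hpY
    · have hadj : (bypass G S).Adj (leaf p) x₀ :=
        ⟨fun e => h.leaf_notMem_x p hw (e ▸ h.x_mem), .trans hpS hlp
          (.adj (h.clique_x p hpX x₀ h.x_mem fun e => h.x_notMem (e ▸ hw)))⟩
      exact hadj.reachIn ha ⟨h.subset_x h.x_mem, fun hx => h.x_notMem (hD hx)⟩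
    · have hadj : (bypass G S).Adj (leaf p) y₀ :=
        ⟨fun e => h.leaf_notMem_y p hw (e ▸ h.y_mem), .trans hpS hlp
          (.adj (h.clique_y p hpY y₀ h.y_mem fun e => h.y_notMem (e ▸ hw)))⟩
      have hyD : y₀ ∉ D := fun hy => h.y_notMem (hD hy)
      exact (hadj.reachIn ha ⟨h.subset_y h.y_mem, hyD⟩).trans
        (h.reachIn_x hD (.inr h.y_mem) hyD)

theorem leaf_notMem (h : StarLike G A W X Y x₀ y₀ leaf)
    {w : V} (hw : w ∈ W) : leaf w ∉ W := fun hl =>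
  (h.mem_or_of_mem _ hl).elim (h.leaf_notMem_x w hw) (h.leaf_notMem_y w hw)

/-- Removing a whiskered vertex creates exactly one new component. -/
theorem cComp_diff (h : StarLike G A W X Y x₀ y₀ leaf)
    [Finite V] (hD : D ⊆ W) {v : V} (hv : v ∈ W) (hvS : v ∉ S) (hvD : v ∉ D) :
    cComp (bypass G S) ((A \ D) \ {v}) = cComp (bypass G S) (A \ D) + 1 := by
  have hD' : D ∪ {v} ⊆ W := Set.union_subset hD (Set.singleton_subset_iff.2 hv)
  have hvA : v ∈ A := (h.mem_or_of_mem v hv).elim (fun e => h.subset_x e) fun e => h.subset_y e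
  apply le_antisymm
  · refine cComp_diff_le_succ {leaf v} fun p q hp hq hpA hqA hpq => ?_
    by_cases hpv : p = leaf v
    · have hqv : q = leaf v := hpq.1 hpv
      subst hpv hqv
      exact .refl hpA
    · have hqv : q ≠ leaf v := fun e => hpv (hpq.2 e)
      rw [Set.sdiff_sdiff] at hpA hqA ⊢
      exact (h.reachIn_x_of_adj hD' hp hpA hpv).trans
        (h.reachIn_x_of_adj hD' hq hqA hqv).symm
  · have key : ∃ q, q ∉ W ∧ q ∈ A ∧ q ≠ leaf v ∧ G.Adj v q := by
      rcases h.mem_or_of_mem v hv with hvX | hvY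
      · exact ⟨x₀, h.x_notMem, h.subset_x h.x_mem, fun e => h.leaf_notMem_x v hv (e ▸ h.x_mem),
          h.clique_x v hvX x₀ h.x_mem fun e => h.x_notMem (e ▸ hv)⟩
      · exact ⟨y₀, h.y_notMem, h.subset_y h.y_mem, fun e => h.leaf_notMem_y v hv (e ▸ h.y_mem),
          h.clique_y v hvY y₀ h.y_mem fun e => h.y_notMem (e ▸ hv)⟩
    obtain ⟨q, hqW, hqA, hqv, hvq⟩ := key
    have hl : G.Adj (leaf v) v := (h.leaf_adj v hv v).2 rfl
    refine cComp_lt_diff ⟨hvA, hvD⟩ hl.symm.bypass hvq.bypass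
      ⟨h.leaf_mem v hv, fun e => h.leaf_notMem hv (hD e)⟩ ⟨hqA, fun e => hqW (hD e)⟩ fun hr => ?_
    refine ReachIn.head_induction (P := fun a => a ≠ leaf v) hqv ?_ hr rfl
    rintro a c - hc hac - rfl
    obtain ⟨p, hp, hpc⟩ := hac.2.exists_adj
    rw [h.leaf_adj v hv] at hp
    subst hp
    exact hpc.elim (fun e => hc.2 e.symm) fun e => hvS e.1

theorem cutVertexOn (h : StarLike G A W X Y x₀ y₀ leaf)
    [Finite V] (hD : D ⊆ W) {v : V} (hv : v ∈ W) (hvS : v ∉ S) (hvD : v ∉ D) :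
    CutVertexOn (bypass G S) (A \ D) v := by
  refine ⟨⟨(h.mem_or_of_mem v hv).elim (fun e => h.subset_x e) fun e => h.subset_y e, hvD⟩, ?_⟩
  rw [h.cComp_diff hD hv hvS hvD]
  exact Nat.lt_succ_self _

theorem cComp_diff_finset (h : StarLike G A W X Y x₀ y₀ leaf)
    [Finite V] [DecidableEq V] (hD : D ⊆ W) (T : Finset V)
    (hT : ∀ t ∈ T, t ∈ W ∧ t ∉ S ∧ t ∉ D) :
    cComp (bypass G S) ((A \ D) \ ↑T) = T.card + cComp (bypass G S) (A \ D) := by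
  induction T using Finset.induction_on with
  | empty => simp
  | insert t T htT ih =>
    have ht := hT t (Finset.mem_insert_self t T)
    have hT' : ∀ t ∈ T, t ∈ W ∧ t ∉ S ∧ t ∉ D := fun s hs => hT s (Finset.mem_insert_of_mem hs)
    have hsub : D ∪ ↑T ⊆ W := Set.union_subset hD fun s hs => (hT' s hs).1
    have := h.cComp_diff hsub ht.1 ht.2.1
      (fun e => e.elim ht.2.2 fun e => htT (Finset.mem_coe.1 e))
    rw [← Set.sdiff_sdiff, ih hT'] at this
    rw [Finset.coe_insert, ← Set.union_singleton, ← Set.sdiff_sdiff, this,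
      Finset.card_insert_of_notMem htT]
    ring

theorem freeOn_x (h : StarLike G A W X Y x₀ y₀ leaf)
    {B : Set V} (hy : y₀ ∉ B) : FreeOn G B x₀ := fun p hp q hq hxp hxq =>
  h.clique_x p ((h.nbr_x p hxp).resolve_right fun e => hy (e ▸ hp))
    q ((h.nbr_x q hxq).resolve_right fun e => hy (e ▸ hq))

/-- A vertex of a cutset is whiskered or is an end of the edge `x₀y₀`. -/
theorem mem_of_cutVertexOn (h : StarLike G A W X Y x₀ y₀ leaf)
    [Finite V] {B : Set V} (hBA : B ⊆ A) {t : V}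
    (ht : CutVertexOn (bypass G S) B t) : t ∉ S ∧ (t ∈ W ∨ t = x₀ ∨ t = y₀) := by
  constructor
  · exact fun htS => (FreeOn.bypass (.inl htS)).not_cutVertexOn ht
  · by_contra! hcon
    exact (FreeOn.bypass (.inr ((h.free t (hBA ht.1) hcon.1 hcon.2.1 hcon.2.2).freeOn _))
      ).not_cutVertexOn ht

/-- A cutset containing `x₀` consists of `x₀` and of whiskered vertices. -/
theorem mem_of_mem_erase_x (h : StarLike G A W X Y x₀ y₀ leaf)
    [Finite V] [DecidableEq V] {B : Set V} (hBA : B ⊆ A) {T : Finset V}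
    (hT : CutsetOn (bypass G S) B T) (hx : x₀ ∈ T) : ∀ t ∈ T.erase x₀, t ∈ W := by
  intro t ht
  obtain ⟨htx, htT⟩ := Finset.mem_erase.1 ht
  obtain ⟨htS, htW | rfl | rfl⟩ :=
    h.mem_of_cutVertexOn (Set.sdiff_subset.trans hBA) (hT.2 t htT)
  · exact htW
  · exact absurd rfl htx
  · refine absurd (hT.2 x₀ hx) (FreeOn.not_cutVertexOn (FreeOn.bypass (.inr (h.freeOn_x ?_))))
    rintro (hy | hy)
    · exact hy.2 (Finset.mem_coe.2 ht)
    · exact htS hy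

theorem card_of_cutsetOn_of_x_mem (h : StarLike G A W X Y x₀ y₀ leaf)
    [Finite V] [DecidableEq V] (hD : D ⊆ W) {T : Finset V}
    (hT : CutsetOn (bypass G S) (A \ D) T) (hx : x₀ ∈ T) :
    cComp (bypass G S) ((A \ D) \ ↑T) = T.card + cComp (bypass G S) (A \ D) := by
  have hE := h.mem_of_mem_erase_x Set.sdiff_subset hT hx
  have hcard := h.cComp_diff_finset (S := S) hD (T.erase x₀) fun t ht =>
    ⟨hE t ht, (h.mem_of_cutVertexOn (Set.sdiff_subset.trans Set.sdiff_subset)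
      (hT.2 t (Finset.mem_of_mem_erase ht))).1, (hT.1 (Finset.mem_of_mem_erase ht)).2⟩
  have hlt := (hT.2 x₀ hx).2
  have hle := cComp_bypass_diff_le_succ (S := S) h.clique_x h.nbr_x ((A \ D) \ ↑(T.erase x₀))
  have heq : ((A \ D) \ ↑(T.erase x₀)) \ {x₀} = (A \ D) \ ↑T := by
    rw [Set.sdiff_sdiff, Finset.coe_erase, Set.sdiff_union_self, Set.union_eq_self_of_subset_right]
    simpa using hx
  rw [heq] at hlt hle
  rw [← Finset.card_erase_add_one hx]
  omega

theorem unmixedOn (h : StarLike G A W X Y x₀ y₀ leaf) [Finite V] [DecidableEq V] (hD : D ⊆ W) :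
    UnmixedOn (bypass G S) (A \ D) := by
  intro T hT
  by_cases hx : x₀ ∈ T
  · exact h.card_of_cutsetOn_of_x_mem hD hT hx
  by_cases hy : y₀ ∈ T
  · exact h.symm.card_of_cutsetOn_of_x_mem hD hT hy
  · refine h.cComp_diff_finset hD T fun t ht => ?_
    have := h.mem_of_cutVertexOn (Set.sdiff_subset.trans Set.sdiff_subset) (hT.2 t ht)
    refine ⟨this.2.resolve_right ?_, this.1, (hT.1 ht).2⟩
    rintro (rfl | rfl)
    · exact hx ht
    · exact hy ht

theorem cutsetOn (h : StarLike G A W X Y x₀ y₀ leaf)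
    [Finite V] [DecidableEq V] {T : Finset V} (hT : ∀ t ∈ T, t ∈ W) :
    CutsetOn G A T := by
  refine ⟨fun t ht => (h.mem_or_of_mem t (hT t ht)).elim (fun e => h.subset_x e)
    fun e => h.subset_y e, fun t ht => ?_⟩
  have := h.cutVertexOn (S := ∅) (D := ↑(T.erase t))
    (fun s hs => hT s (Finset.mem_of_mem_erase hs)) (hT t ht) (Set.notMem_empty t)
    (fun e => Finset.notMem_erase t T e)
  rwa [bypass_empty] at this

theorem unmixedOn_self (h : StarLike G A W X Y x₀ y₀ leaf)
    [Finite V] [DecidableEq V] : UnmixedOn G A := by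
  have := h.unmixedOn (S := ∅) (Set.empty_subset W)
  rwa [bypass_empty, Set.sdiff_empty] at this

theorem accessibleOn (h : StarLike G A W X Y x₀ y₀ leaf)
    [Finite V] [DecidableEq V] : AccessibleOn G A := by
  refine ⟨h.unmixedOn_self, fun T hT hne => ?_⟩
  have hT' : CutsetOn (bypass G ∅) A T := by rwa [bypass_empty]
  by_cases hx : x₀ ∈ T
  · exact ⟨x₀, hx, h.cutsetOn (h.mem_of_mem_erase_x subset_rfl hT' hx)⟩
  by_cases hy : y₀ ∈ T
  · exact ⟨y₀, hy, h.cutsetOn (h.symm.mem_of_mem_erase_x subset_rfl hT' hy)⟩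
  · obtain ⟨t, ht⟩ := hne
    refine ⟨t, ht, h.cutsetOn fun s hs => ?_⟩
    have hsT := Finset.mem_of_mem_erase hs
    refine (h.mem_of_cutVertexOn Set.sdiff_subset (hT'.2 s hsT)).2.resolve_right ?_
    rintro (rfl | rfl)
    · exact hx hsT
    · exact hy hsT

/-- The case where only `y₀` can fail to be a free vertex. -/
theorem stronglyUnmixedOn_of_subset_insert_y (h : StarLike G A W X Y x₀ y₀ leaf)
    [Finite V] [DecidableEq V] {B : Set V}
    (hBA : B ⊆ A) (hy : y₀ ∈ B) (hxS : x₀ ∈ S) (hB : ∀ v ∈ B, v ∈ W → v ∈ S) :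
    StronglyUnmixedOn (bypass G S) B := by
  have hfree : ∀ v ∈ B, v = y₀ ∨ v ∈ S ∨ FreeVertex G v := by
    intro v hv
    by_cases hvy : v = y₀
    · exact .inl hvy
    by_cases hvx : v = x₀
    · exact .inr (.inl (hvx ▸ hxS))
    by_cases hvW : v ∈ W
    · exact .inr (.inl (hB v hv hvW))
    · exact .inr (.inr (h.free v (hBA hv) hvW hvx hvy))
  have hU : UnmixedOn (bypass G S) B := by
    intro T hT
    have hTy : T ⊆ {y₀} := by
      intro t ht
      rcases hfree t (hT.1 ht) with rfl | htS | htF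
      · exact Finset.mem_singleton_self _
      · exact absurd (hT.2 t ht) (FreeOn.bypass (.inl htS)).not_cutVertexOn
      · exact absurd (hT.2 t ht) (FreeOn.bypass (.inr (htF.freeOn _))).not_cutVertexOn
    rcases Finset.subset_singleton_iff.1 hTy with rfl | rfl
    · simp
    · have hlt := (hT.2 y₀ (Finset.mem_singleton_self y₀)).2
      have hle := cComp_bypass_diff_le_succ (S := S) h.clique_y h.nbr_y B
      simp only [Finset.erase_singleton, Finset.coe_empty, Set.sdiff_empty] at hlt
      rw [Finset.coe_singleton, Finset.card_singleton]
      omega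
  have hins : CompleteOn (bypass G (insert y₀ S)) B := by
    refine completeOn_of_freeOn fun v hv => FreeOn.bypass ?_
    rcases hfree v hv with rfl | hvS | hvF
    · exact .inl (Set.mem_insert _ _)
    · exact .inl (Set.mem_insert_of_mem _ hvS)
    · exact .inr (hvF.freeOn _)
  have hins' : CompleteOn (bypass G (insert y₀ S)) (B \ {y₀}) :=
    fun a b hab => hins a b (hab.mono Set.sdiff_subset)
  refine StronglyUnmixedOn.of_completeOn_diff hy hU ?_
    (hins.stronglyUnmixedOn.congr (agreeOn_bypass_insert B y₀))
    (hins'.stronglyUnmixedOn.congr ((agreeOn_bypass_insert B y₀).mono Set.sdiff_subset))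
  refine completeOn_of_freeOn fun v hv => FreeOn.bypass ?_
  rcases hfree v hv.1 with rfl | hvS | hvF
  · exact absurd rfl hv.2
  · exact .inl hvS
  · exact .inr (hvF.freeOn _)

/-- The case where only `x₀` and `y₀` can fail to be free vertices. -/
theorem stronglyUnmixedOn_of_subset (h : StarLike G A W X Y x₀ y₀ leaf)
    [Finite V] [DecidableEq V] (hD : D ⊆ W) (hS : S ⊆ W)
    (hW : ∀ w ∈ W, w ∈ S ∨ w ∈ D) : StronglyUnmixedOn (bypass G S) (A \ D) := by
  have hxA : x₀ ∈ A \ D := ⟨h.subset_x h.x_mem, fun hx => h.x_notMem (hD hx)⟩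
  have hyA : y₀ ∈ A \ D := ⟨h.subset_y h.y_mem, fun hy => h.y_notMem (hD hy)⟩
  have hins : ∀ B ⊆ A \ D, y₀ ∈ B → StronglyUnmixedOn (bypass G (insert x₀ S)) B :=
    fun B hB hy => h.stronglyUnmixedOn_of_subset_insert_y (hB.trans Set.sdiff_subset) hy
      (Set.mem_insert _ _) fun v hv hvW =>
        Set.mem_insert_of_mem _ ((hW v hvW).resolve_right (hB hv).2)
  refine StronglyUnmixedOn.of_completeOn_diff hxA (h.unmixedOn hD) ?_
    ((hins _ subset_rfl hyA).congr (agreeOn_bypass_insert _ x₀))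
    ((hins _ Set.sdiff_subset ⟨hyA, h.adj.ne'⟩).congr
      ((agreeOn_bypass_insert _ x₀).mono Set.sdiff_subset))
  refine completeOn_of_freeOn fun v hv => FreeOn.bypass ?_
  by_cases hvW : v ∈ W
  · exact .inl ((hW v hvW).resolve_right hv.1.2)
  by_cases hvy : v = y₀
  · subst hvy
    refine .inr (h.symm.freeOn_x ?_)
    rintro (hx | hx)
    · exact hx.2 rfl
    · exact h.x_notMem (hS hx)
  · exact .inr ((h.free v hv.1.1 hvW hv.2 hvy).freeOn _)

theorem stronglyUnmixedOn_bypass (h : StarLike G A W X Y x₀ y₀ leaf)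
    [Finite V] [DecidableEq V] (hD : D ⊆ W) (hS : S ⊆ W) :
    StronglyUnmixedOn (bypass G S) (A \ D) := by
  induction hk : (W \ (S ∪ D)).ncard using Nat.strong_induction_on generalizing S D with
  | _ k ih =>
    by_cases hW : ∀ w ∈ W, w ∈ S ∨ w ∈ D
    · exact h.stronglyUnmixedOn_of_subset hD hS hW
    · push Not at hW
      obtain ⟨v, hv, hvS, hvD⟩ := hW
      have hlt : ∀ E : Set V, S ∪ D ⊆ E → v ∈ E → (W \ E).ncard < k := fun E hE hvE =>
        hk ▸ Set.ncard_lt_ncard ⟨Set.sdiff_subset_sdiff_right hE, fun hsub =>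
          (hsub (show v ∈ W \ (S ∪ D) from ⟨hv, fun e => e.elim hvS hvD⟩)).2 hvE⟩ (Set.toFinite _)
      have hD' : D ∪ {v} ⊆ W := Set.union_subset hD (Set.singleton_subset_iff.2 hv)
      have hS' : insert v S ⊆ W := Set.insert_subset hv hS
      have hagree := agreeOn_bypass_insert (G := G) (S := S) (A \ D) v
      refine .cut _ _ (h.unmixedOn hD) v (h.cutVertexOn hD hv hvS hvD) ?_ ?_ ?_
      · rw [Set.sdiff_sdiff]
        exact ih _ (hlt (S ∪ (D ∪ {v})) (by grind) (by grind)) hD' hS rfl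
      · exact (ih _ (hlt (insert v S ∪ D) (by grind) (by grind)) hD hS' rfl).congr hagree
      · refine StronglyUnmixedOn.congr ?_ (hagree.mono Set.sdiff_subset)
        rw [Set.sdiff_sdiff]
        exact ih _ (hlt (insert v S ∪ (D ∪ {v})) (by grind) (by grind)) hD' hS' rfl

theorem stronglyUnmixedOn (h : StarLike G A W X Y x₀ y₀ leaf)
    [Finite V] [DecidableEq V] : StronglyUnmixedOn G A := by
  have := h.stronglyUnmixedOn_bypass (Set.empty_subset W) (Set.empty_subset W)
  rwa [bypass_empty, Set.sdiff_empty] at this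

end StarLike

end StarLike

theorem starLike_star_product {m n r : ℕ} (hr : 1 ≤ r) (hm : r ≤ m) (hn : r ≤ n) :
    StarLike (whiskered (starProd m n r) (starWhisk m n r))
      (Set.range Sum.inl ∪ Sum.inr '' starWhisk m n r) (Sum.inl '' starWhisk m n r)
      (Set.range (Sum.inl ∘ Sum.inl)) (Set.range (Sum.inl ∘ Sum.inr))
      (Sum.inl (Sum.inl ⟨0, by omega⟩)) (Sum.inl (Sum.inr ⟨0, by omega⟩))
      (Sum.elim Sum.inr Sum.inr) := by
  have hxx : ∀ a b : Fin m, (whiskered (starProd m n r) (starWhisk m n r)).Adj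
      (.inl (.inl a)) (.inl (.inl b)) ↔ a ≠ b := by
    intro a b
    simp [whiskered, starProd]
    tauto
  have hyy : ∀ a b : Fin n, (whiskered (starProd m n r) (starWhisk m n r)).Adj
      (.inl (.inr a)) (.inl (.inr b)) ↔ a ≠ b := by
    intro a b
    simp [whiskered, starProd]
    tauto
  have hxy : ∀ (a : Fin m) (b : Fin n), (whiskered (starProd m n r) (starWhisk m n r)).Adj
      (.inl (.inl a)) (.inl (.inr b)) ↔ (a : ℕ) = b ∧ (a : ℕ) < r := by
    intro a b
    simp [whiskered, starProd]
  have hyx : ∀ (a : Fin m) (b : Fin n), (whiskered (starProd m n r) (starWhisk m n r)).Adj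
      (.inl (.inr b)) (.inl (.inl a)) ↔ (a : ℕ) = b ∧ (a : ℕ) < r := fun a b => by
    rw [SimpleGraph.adj_comm, hxy]
  have hlf : ∀ a b, (whiskered (starProd m n r) (starWhisk m n r)).Adj
      (.inl a) (.inr b) ↔ a = b ∧ a ∈ starWhisk m n r := by
    intro a b
    simp [whiskered]
    aesop
  have hfl : ∀ a b, (whiskered (starProd m n r) (starWhisk m n r)).Adj
      (.inr b) (.inl a) ↔ a = b ∧ a ∈ starWhisk m n r := fun a b => by
    rw [SimpleGraph.adj_comm, hlf]
  have hff : ∀ a b, ¬ (whiskered (starProd m n r) (starWhisk m n r)).Adj (.inr a) (.inr b) := by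
    intro a b
    simp [whiskered]
  have hWx : ∀ a : Fin m, Sum.inl a ∈ starWhisk m n r ↔ 1 ≤ (a : ℕ) ∧ (a : ℕ) < r := by
    intro a
    simp [starWhisk]
  have hWy : ∀ b : Fin n, Sum.inr b ∈ starWhisk m n r ↔ 1 ≤ (b : ℕ) ∧ (b : ℕ) < r := by
    intro b
    simp [starWhisk]
  constructor
  · simp
  · simp
  · rintro _ ⟨a, rfl⟩ _ ⟨b, rfl⟩ hab
    exact (hxx a b).2 fun e => hab (e ▸ rfl)
  · rintro _ ⟨a, rfl⟩ _ ⟨b, rfl⟩ hab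
    exact (hyy a b).2 fun e => hab (e ▸ rfl)
  · exact (hxy _ _).2 ⟨rfl, hr⟩
  · rintro _ ⟨a, rfl⟩
    exact .inl ⟨_, rfl⟩
  · rintro _ ⟨a, rfl⟩
    exact .inl ⟨_, rfl⟩
  · rintro ⟨a, ha, hax⟩
    cases hax
    exact absurd ((hWx _).1 ha).1 (by simp)
  · rintro ⟨a, ha, hax⟩
    cases hax
    exact absurd ((hWy _).1 ha).1 (by simp)
  · rintro _ ⟨a | a, -, rfl⟩
    · exact .inl ⟨a, rfl⟩
    · exact .inr ⟨a, rfl⟩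
  · rintro _ ⟨a, ha, rfl⟩
    exact .inr ⟨a, ha, rfl⟩
  · rintro _ ⟨a, ha, rfl⟩ (b | b)
    · simp only [Sum.elim_inl, hfl, Sum.inl.injEq]
      grind
    · simp [hff]
  · rintro _ ⟨a, -, rfl⟩ ⟨b, hb⟩
    cases hb
  · rintro _ ⟨a, -, rfl⟩ ⟨b, hb⟩
    cases hb
  · rintro ((b | b) | b) hb
    · exact .inl ⟨b, rfl⟩
    · rw [hxy] at hb
      exact .inr (congrArg _ (congrArg _ (Fin.ext hb.1.symm)))
    · rw [hlf, hWx] at hb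
      exact absurd hb.2.1 (by simp)
  · rintro ((b | b) | b) hb
    · rw [hyx] at hb
      exact .inr (congrArg _ (congrArg _ (Fin.ext hb.1)))
    · exact .inl ⟨b, rfl⟩
    · rw [hlf, hWy] at hb
      exact absurd hb.2.1 (by simp)
  · rintro _ (⟨a | a, rfl⟩ | ⟨a, ha, rfl⟩)
    · exact .inl ⟨a, rfl⟩
    · exact .inr (.inl ⟨a, rfl⟩)
    · exact .inr (.inr ⟨_, ⟨a, ha, rfl⟩, rfl⟩)
  · rintro _ (⟨a | a, rfl⟩ | ⟨a, ha, rfl⟩) hW hx hy p q hp hq hpq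
    · have ha : ¬ (a : ℕ) < r := fun har => by
        refine hW ⟨_, (hWx a).2 ⟨Nat.one_le_iff_ne_zero.2 fun h0 => hx ?_, har⟩, rfl⟩
        exact congrArg _ (congrArg _ (Fin.ext h0))
      have key : ∀ p, (whiskered (starProd m n r) (starWhisk m n r)).Adj (.inl (.inl a)) p →
          ∃ b, p = .inl (.inl b) := by
        rintro ((b | b) | b) hb
        · exact ⟨b, rfl⟩
        · exact absurd ((hxy _ _).1 hb).2 ha
        · exact absurd ((hWx _).1 ((hlf _ _).1 hb).2).2 ha
      obtain ⟨p, rfl⟩ := key p hp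
      obtain ⟨q, rfl⟩ := key q hq
      exact (hxx p q).2 fun e => hpq (e ▸ rfl)
    · have ha : ¬ (a : ℕ) < r := fun har => by
        refine hW ⟨_, (hWy a).2 ⟨Nat.one_le_iff_ne_zero.2 fun h0 => hy ?_, har⟩, rfl⟩
        exact congrArg _ (congrArg _ (Fin.ext h0))
      have key : ∀ p, (whiskered (starProd m n r) (starWhisk m n r)).Adj (.inl (.inr a)) p →
          ∃ b, p = .inl (.inr b) := by
        rintro ((b | b) | b) hb
        · have hb := (hyx _ _).1 hb
          exact absurd (hb.1 ▸ hb.2) ha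
        · exact ⟨b, rfl⟩
        · exact absurd ((hWy _).1 ((hlf _ _).1 hb).2).2 ha
      obtain ⟨p, rfl⟩ := key p hp
      obtain ⟨q, rfl⟩ := key q hq
      exact (hyy p q).2 fun e => hpq (e ▸ rfl)
    · have key : ∀ p, (whiskered (starProd m n r) (starWhisk m n r)).Adj (.inr a) p →
          p = .inl a := by
        rintro (b | b) hb
        · exact congrArg _ ((hfl _ _).1 hb).1
        · exact absurd hb (hff _ _)
      exact absurd ((key p hp).trans (key q hq).symm) hpq

/-- for positive integers `r ≤ m`, `r ≤ n`, the binomial edge ideal of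
`overline(K_m ⋆_r K_n)` is strongly unmixed (in particular `overline(K_m ⋆_r K_n)`
is accessible and its binomial edge ideal is unmixed). -/
theorem stronglyUnmixed_star_product (m n r : ℕ) (hr : 1 ≤ r) (hm : r ≤ m) (hn : r ≤ n) :
    StronglyUnmixedOn (whiskered (starProd m n r) (starWhisk m n r))
        (Set.range Sum.inl ∪ Sum.inr '' starWhisk m n r) ∧
    AccessibleOn (whiskered (starProd m n r) (starWhisk m n r))
        (Set.range Sum.inl ∪ Sum.inr '' starWhisk m n r) ∧
    UnmixedOn (whiskered (starProd m n r) (starWhisk m n r))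
        (Set.range Sum.inl ∪ Sum.inr '' starWhisk m n r) := by
  have h := starLike_star_product hr hm hn
  exact ⟨h.stronglyUnmixedOn, h.accessibleOn, h.unmixedOn_self⟩
end

section
/- Let B be a connected non-complete graph with no cut vertex that is r-regular and r-connected, and let B̄ be a graph obtained from B by attaching a whisker (one new pendant vertex with one edge) at each vertex of some subset of V(B). If B̄ is accessible, then r ≥ 2 and B̄ is isomorphic to overline(K_r ⋆ K_r). -/
open SimpleGraph

universe u u'

/-- A surjection whose fibres are the reachability classes counts the connected components. -/
theorem card_connectedComponent_eq {V X : Type*} {G : SimpleGraph V} (f : V → X)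
    (hf : Function.Surjective f) (h : ∀ a b, f a = f b ↔ G.Reachable a b) :
    Nat.card G.ConnectedComponent = Nat.card X := by
  refine Nat.card_congr (Equiv.ofBijective
    (SimpleGraph.ConnectedComponent.lift f fun v w p _ => (h v w).2 p.reachable) ⟨?_, ?_⟩)
  · intro c d
    refine SimpleGraph.ConnectedComponent.ind₂ (fun a b hab => ?_) c d
    exact SimpleGraph.ConnectedComponent.eq.2 ((h a b).1 hab)
  · intro x
    obtain ⟨a, rfl⟩ := hf x
    exact ⟨G.connectedComponentMk a, rfl⟩

theorem eq_of_reachable {V X : Type*} {G : SimpleGraph V} {f : V → X}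
    (h : ∀ a b, G.Adj a b → f a = f b) {a b : V} (hab : G.Reachable a b) : f a = f b := by
  obtain ⟨p⟩ := hab
  induction p with
  | nil => rfl
  | cons hadj _ ih => exact (h _ _ hadj).trans ih

theorem le_cComp {V : Type*} [Finite V] {G : SimpleGraph V} {D : Set V} {n : ℕ} (f : V → Fin n)
    (hf : ∀ i, ∃ a ∈ D, f a = i) (h : ∀ a ∈ D, ∀ b ∈ D, G.Adj a b → f a = f b) :
    n ≤ cComp G D := by
  rw [cComp, ← Nat.card_fin n]
  refine Nat.card_le_card_of_surjective
    (SimpleGraph.ConnectedComponent.lift (fun a : D => f a) fun v w p _ =>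
      eq_of_reachable (f := fun a : D => f a) (fun a b hab => h a a.2 b b.2 hab) p.reachable) ?_
  intro i
  obtain ⟨a, ha, rfl⟩ := hf i
  exact ⟨(G.induce D).connectedComponentMk ⟨a, ha⟩, rfl⟩

theorem cComp_eq_one_of_connected {V : Type*} {G : SimpleGraph V} {D : Set V}
    (h : (G.induce D).Connected) : cComp G D = 1 := by
  obtain ⟨a⟩ := h.nonempty
  rw [cComp, card_connectedComponent_eq (fun _ => ()) (fun _ => ⟨a, rfl⟩)
    fun a b => ⟨fun _ => h.preconnected a b, fun _ => rfl⟩]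
  simp

theorem cComp_insert_le {V : Type*} [Finite V] {G : SimpleGraph V} {D : Set V} {t d : V}
    (hd : d ∈ D) (h : G.Adj t d) : cComp G (insert t D) ≤ cComp G D := by
  refine Nat.card_le_card_of_surjective
    (SimpleGraph.ConnectedComponent.map
      (SimpleGraph.induceHomOfLE G (Set.subset_insert t D)).toHom) ?_
  intro c
  induction c using SimpleGraph.ConnectedComponent.ind with
  | h v =>
    obtain ⟨v, rfl | hv⟩ := v
    · refine ⟨(G.induce D).connectedComponentMk ⟨d, hd⟩, ?_⟩
      refine SimpleGraph.ConnectedComponent.eq.2 (SimpleGraph.Adj.reachable ?_)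
      exact h.symm
    · exact ⟨(G.induce D).connectedComponentMk ⟨v, hv⟩, rfl⟩

section whiskered

variable {V : Type*} {B : SimpleGraph V} {S : Set V}

@[simp] theorem whiskered_adj_inl_inl {x y : V} :
    (whiskered B S).Adj (Sum.inl x) (Sum.inl y) ↔ B.Adj x y := by
  simp only [whiskered, SimpleGraph.fromRel_adj]
  constructor
  · rintro ⟨-, (⟨x, y, h, hx, hy⟩ | ⟨x, -, -, h⟩) | ⟨x, y, h, hx, hy⟩ | ⟨x, -, -, h⟩⟩
    · cases hx; cases hy; exact h
    · cases h
    · cases hx; cases hy; exact h.symm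
    · cases h
  · intro h
    exact ⟨by simpa using h.ne, Or.inl (Or.inl ⟨x, y, h, rfl, rfl⟩)⟩

@[simp] theorem whiskered_adj_inl_inr {x y : V} :
    (whiskered B S).Adj (Sum.inl x) (Sum.inr y) ↔ x = y ∧ x ∈ S := by
  simp [whiskered, SimpleGraph.fromRel_adj]
  grind

@[simp] theorem whiskered_adj_inr_inl {x y : V} :
    (whiskered B S).Adj (Sum.inr x) (Sum.inl y) ↔ x = y ∧ x ∈ S := by
  rw [SimpleGraph.adj_comm, whiskered_adj_inl_inr]
  grind

@[simp] theorem not_whiskered_adj_inr_inr {x y : V} :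
    ¬ (whiskered B S).Adj (Sum.inr x) (Sum.inr y) := by
  simp [whiskered, SimpleGraph.fromRel_adj]

theorem cComp_whiskered [Finite V] (D : Set V) :
    cComp (whiskered B S) (Sum.inl '' D ∪ Sum.inr '' S) = cComp B D + (S \ D).ncard := by
  classical
  let p : V ⊕ V → V := Sum.elim id id
  let A : Set (V ⊕ V) := Sum.inl '' D ∪ Sum.inr '' S
  have hAl : ∀ x, Sum.inl x ∈ A ↔ x ∈ D := by simp [A]
  have hAr : ∀ x, Sum.inr x ∈ A ↔ x ∈ S := by simp [A]
  have hp : ∀ v : A, p v ∉ D → p v ∈ S ∧ v.1 = Sum.inr (p v) := by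
    rintro ⟨v | v, hv⟩ h
    · exact absurd ((hAl v).1 hv) h
    · exact ⟨(hAr v).1 hv, rfl⟩
  let f : A → (B.induce D).ConnectedComponent ⊕ ↑(S \ D) := fun v =>
    if h : p v ∈ D then Sum.inl ((B.induce D).connectedComponentMk ⟨p v, h⟩)
    else Sum.inr ⟨p v, (hp v h).1, h⟩
  have hfD : ∀ (v : A) (h : p v ∈ D), f v = Sum.inl ((B.induce D).connectedComponentMk ⟨p v, h⟩) :=
    fun v h => dif_pos h
  have hfD' : ∀ (v : A) (h : p v ∉ D), f v = Sum.inr ⟨p v, (hp v h).1, h⟩ := fun v h => dif_neg h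
  let ι : B.induce D →g (whiskered B S).induce A :=
    { toFun := fun x => ⟨Sum.inl x, Or.inl ⟨x, x.2, rfl⟩⟩
      map_rel' := fun {a b} h => whiskered_adj_inl_inl.2 h }
  have hι : ∀ (v : A) (h : p v ∈ D), ((whiskered B S).induce A).Reachable v (ι ⟨p v, h⟩) := by
    rintro ⟨v | v, hv⟩ h
    · exact SimpleGraph.Reachable.refl _
    · refine SimpleGraph.Adj.reachable (whiskered_adj_inr_inl.2 ⟨rfl, ?_⟩)
      simpa [A] using hv
  have hfadj : ∀ a b, ((whiskered B S).induce A).Adj a b → f a = f b := by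
    intro a b hab
    have hpab : p a = p b ∨ (p a ∈ D ∧ p b ∈ D ∧ B.Adj (p a) (p b)) := by
      obtain ⟨a | a, ha⟩ := a <;> obtain ⟨b | b, hb⟩ := b
      · exact Or.inr ⟨(hAl a).1 ha, (hAl b).1 hb, whiskered_adj_inl_inl.1 hab⟩
      · exact Or.inl (whiskered_adj_inl_inr.1 hab).1
      · exact Or.inl (whiskered_adj_inr_inl.1 hab).1
      · exact absurd hab not_whiskered_adj_inr_inr
    rcases hpab with h | ⟨ha, hb, h⟩
    · simp only [f, h]
    · rw [hfD a ha, hfD b hb]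
      exact congrArg _ (SimpleGraph.ConnectedComponent.eq.2 (SimpleGraph.Adj.reachable h))
  rw [cComp, card_connectedComponent_eq f, Nat.card_sum, cComp, Nat.card_coe_set_eq]
  · rintro (c | ⟨s, hs, hsD⟩)
    · induction c using SimpleGraph.ConnectedComponent.ind with
      | h x => exact ⟨ι x, hfD (ι x) x.2⟩
    · exact ⟨⟨Sum.inr s, Or.inr ⟨s, hs, rfl⟩⟩, hfD' ⟨Sum.inr s, Or.inr ⟨s, hs, rfl⟩⟩ hsD⟩
  · refine fun a b => ⟨fun hab => ?_, eq_of_reachable hfadj⟩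
    by_cases ha : p a ∈ D <;> by_cases hb : p b ∈ D
    · rw [hfD a ha, hfD b hb, Sum.inl.injEq, SimpleGraph.ConnectedComponent.eq] at hab
      exact (hι a ha).trans ((hab.map ι).trans (hι b hb).symm)
    · rw [hfD a ha, hfD' b hb] at hab; cases hab
    · rw [hfD' a ha, hfD b hb] at hab; cases hab
    · rw [hfD' a ha, hfD' b hb] at hab
      have hpab : p a = p b := congrArg Subtype.val (Sum.inr.inj hab)
      have : a = b := Subtype.ext (by rw [(hp a ha).2, (hp b hb).2, hpab])
      rw [this]

theorem cComp_whiskered_sdiff [Finite V] [DecidablePred (· ∈ S)] (T : Finset V) :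
    cComp (whiskered B S)
        ((Set.range Sum.inl ∪ Sum.inr '' S) \ ↑(T.map (Function.Embedding.inl : V ↪ V ⊕ V))) =
      cComp B (↑T)ᶜ + (T.filter (· ∈ S)).card := by
  have h : (Set.range Sum.inl ∪ Sum.inr '' S) \
      ↑(T.map (Function.Embedding.inl : V ↪ V ⊕ V)) = Sum.inl '' (↑T : Set V)ᶜ ∪ Sum.inr '' S := by
    ext (x | x) <;> simp
  rw [h, cComp_whiskered, ← Set.ncard_coe_finset]
  congr 2
  ext x
  simp [and_comm]

theorem cutsetOn_whiskered [Finite V] [DecidableEq V] [DecidablePred (· ∈ S)] {T : Finset V}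
    (h : ∀ t ∈ T, cComp B (↑(T.erase t))ᶜ + ((T.erase t).filter (· ∈ S)).card <
      cComp B (↑T)ᶜ + (T.filter (· ∈ S)).card) :
    CutsetOn (whiskered B S) (Set.range Sum.inl ∪ Sum.inr '' S)
      (T.map Function.Embedding.inl) := by
  constructor
  · intro x
    simp only [Finset.coe_map, Set.mem_image]
    rintro ⟨a, -, rfl⟩
    exact Or.inl ⟨a, rfl⟩
  · intro t' ht'
    obtain ⟨t, ht, rfl⟩ := Finset.mem_map.1 ht'
    have hs : ((Set.range Sum.inl ∪ Sum.inr '' S) \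
        ↑((T.map (Function.Embedding.inl : V ↪ V ⊕ V)).erase (Function.Embedding.inl t))) \
          {Function.Embedding.inl t} = (Set.range Sum.inl ∪ Sum.inr '' S) \
          ↑(T.map (Function.Embedding.inl : V ↪ V ⊕ V)) := by
      ext (x | x) <;> simp
      grind
    refine ⟨by simp, ?_⟩
    rw [hs, ← Finset.map_erase, cComp_whiskered_sdiff, cComp_whiskered_sdiff]
    exact h t ht

theorem UnmixedOn.cComp_add_card [Finite V] [DecidableEq V] [DecidablePred (· ∈ S)]
    (h : UnmixedOn (whiskered B S) (Set.range Sum.inl ∪ Sum.inr '' S)) (hB : B.Connected)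
    {T : Finset V} (hT : CutsetOn (whiskered B S) (Set.range Sum.inl ∪ Sum.inr '' S)
      (T.map Function.Embedding.inl)) :
    cComp B (↑T)ᶜ + (T.filter (· ∈ S)).card = T.card + 1 := by
  have h0 : cComp (whiskered B S) (Set.range Sum.inl ∪ Sum.inr '' S) = 1 := by
    have h1 := cComp_whiskered_sdiff (B := B) (S := S) ∅
    have h2 : cComp B Set.univ = 1 :=
      cComp_eq_one_of_connected ((SimpleGraph.induceUnivIso B).connected_iff.2 hB)
    simpa [h2] using h1
  rw [← cComp_whiskered_sdiff, h _ hT, h0, Finset.card_map]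

theorem card_filter_erase_lt [DecidableEq V] [DecidablePred (· ∈ S)] {T : Finset V} {t : V}
    (ht : t ∈ T) (hS : t ∈ S) :
    ((T.erase t).filter (· ∈ S)).card < (T.filter (· ∈ S)).card := by
  rw [Finset.filter_erase]
  exact Finset.card_erase_lt_of_mem (Finset.mem_filter.2 ⟨ht, hS⟩)

theorem cComp_compl_erase_le [Finite V] [DecidableEq V] {T : Finset V} {t d : V}
    (hd : d ∉ T) (h : B.Adj t d) :
    cComp B (↑(T.erase t))ᶜ ≤ cComp B (↑T)ᶜ := by
  have : (↑(T.erase t) : Set V)ᶜ = insert t (↑T)ᶜ := by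
    ext x
    simp
    grind
  rw [this]
  exact cComp_insert_le (by simpa using hd) h

theorem whiskered_induce_iso {W : Type*} {C : SimpleGraph W} {R : Set W} (φ : B ≃g C)
    (h : ∀ x, φ x ∈ R ↔ x ∈ S) :
    Nonempty (((whiskered B S).induce (Set.range Sum.inl ∪ Sum.inr '' S)) ≃g
      ((whiskered C R).induce (Set.range Sum.inl ∪ Sum.inr '' R))) := by
  refine ⟨⟨(Equiv.sumCongr φ.toEquiv φ.toEquiv).subtypeEquiv ?_, ?_⟩⟩
  · rintro (x | x) <;> simp [h]
  · rintro ⟨x | x, hx⟩ ⟨y | y, hy⟩ <;> simp [h, φ.map_adj_iff]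

end whiskered

theorem starProd_adj_inl_inl {m n r : ℕ} {x y : Fin m} :
    (starProd m n r).Adj (Sum.inl x) (Sum.inl y) ↔ x ≠ y := by
  simp [starProd]

theorem starProd_adj_inr_inr {m n r : ℕ} {x y : Fin n} :
    (starProd m n r).Adj (Sum.inr x) (Sum.inr y) ↔ x ≠ y := by
  simp [starProd]

theorem starProd_adj_inl_inr {r : ℕ} {x y : Fin r} :
    (starProd r r r).Adj (Sum.inl x) (Sum.inr y) ↔ x = y := by
  simp only [starProd, SimpleGraph.fromRel_adj, Fin.ext_iff]
  constructor
  · rintro ⟨-, (⟨_, _, h, h'⟩ | ⟨_, _, h, h'⟩ | ⟨_, _, h, -, hx, hy⟩) |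
      (⟨_, _, h, h'⟩ | ⟨_, _, h, h'⟩ | ⟨_, _, -, -, hx, hy⟩)⟩
    · cases h'
    · cases h
    · cases hx; cases hy; exact h
    · cases h
    · cases h'
    · cases hx
  · intro h
    exact ⟨Sum.inl_ne_inr, Or.inl (Or.inr (Or.inr ⟨x, y, h, x.2, rfl, rfl⟩))⟩

/-- An `r`-regular graph whose vertices split into two cliques of size `r` is a star product. -/
theorem exists_iso_starProd {V : Type*} [Finite V] {B : SimpleGraph V} {r : ℕ} {X : Set V}
    (hreg : ∀ x : V, (B.neighborSet x).ncard = r) (hX : X.ncard = r) (hX' : Xᶜ.ncard = r)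
    (hcl : B.IsClique X) (hcl' : B.IsClique Xᶜ) {w w' : V} (hw : w ∈ X) (hw' : w' ∉ X)
    (hww : B.Adj w w') :
    ∃ φ : starProd r r r ≃g B, ∀ a, a ∈ starWhisk r r r ↔ φ a ≠ w ∧ φ a ≠ w' := by
  classical
  have key : ∀ Z : Set V, Z.ncard = r → B.IsClique Z → ∀ x ∈ Z, ∃! y, B.Adj x y ∧ y ∉ Z := by
    intro Z hZ hc x hx
    have h1 : B.neighborSet x \ (B.neighborSet x \ Z) = Z \ {x} := by
      ext y
      simp only [Set.mem_sdiff, SimpleGraph.mem_neighborSet, Set.mem_singleton_iff]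
      constructor
      · intro h
        exact ⟨by tauto, fun e => h.1.ne e.symm⟩
      · intro h
        exact ⟨hc hx h.1 (Ne.symm h.2), by tauto⟩
    have h2 := Set.ncard_sdiff_add_ncard_of_subset
      (Set.sdiff_subset : B.neighborSet x \ Z ⊆ B.neighborSet x)
    rw [h1, hreg] at h2
    have h3 := Set.ncard_sdiff_singleton_add_one hx
    obtain ⟨y, hy⟩ := Set.ncard_eq_one.1 (show (B.neighborSet x \ Z).ncard = 1 by omega)
    have hy' : ∀ z, (B.Adj x z ∧ z ∉ Z) ↔ z = y := fun z => by
      simpa using Set.ext_iff.1 hy z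
    exact ⟨y, (hy' y).2 rfl, fun z hz => (hy' z).1 hz⟩
  have key' : ∀ x, ∃ y, ∀ z, (B.Adj x z ∧ (z ∈ X ↔ x ∉ X)) ↔ z = y := by
    intro x
    by_cases hx : x ∈ X
    · obtain ⟨y, hy, hu⟩ := key X hX hcl x hx
      exact ⟨y, fun z => ⟨fun h => hu z (by grind), by rintro rfl; grind⟩⟩
    · obtain ⟨y, hy, hu⟩ := key Xᶜ hX' hcl' x hx
      exact ⟨y, fun z => ⟨fun h => hu z (by grind), by rintro rfl; grind⟩⟩
  choose m hm using key'
  have hmX : ∀ x, m x ∈ X ↔ x ∉ X := fun x => ((hm x (m x)).2 rfl).2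
  have hmadj : ∀ x, B.Adj x (m x) := fun x => ((hm x (m x)).2 rfl).1
  have hmm : ∀ x, m (m x) = x := fun x =>
    ((hm (m x) x).1 ⟨(hmadj x).symm, by grind⟩).symm
  have hmw : m w = w' := ((hm w w').1 ⟨hww, by grind⟩).symm
  have hr : 0 < r := hX ▸ (Set.ncard_pos).2 ⟨w, hw⟩
  have : NeZero r := ⟨hr.ne'⟩
  let e₀ : Fin r ≃ X := (Finite.equivFinOfCardEq (hX ▸ rfl)).symm
  let e : Fin r ≃ X := e₀.trans (Equiv.swap (e₀ 0) ⟨w, hw⟩)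
  have he : e 0 = ⟨w, hw⟩ := by simp [e]
  have hew : ∀ i, (e i : V) = w ↔ i = 0 := fun i => by
    rw [← e.injective.eq_iff, he, Subtype.ext_iff]
  let F : Fin r ⊕ Fin r → V := Sum.elim (fun i => e i) (fun i => m (e i))
  have hFl : ∀ i, F (Sum.inl i) = e i := fun _ => rfl
  have hFr : ∀ i, F (Sum.inr i) = m (e i) := fun _ => rfl
  have hmem : ∀ i, (e i : V) ∈ X := fun i => (e i).2
  have hmem' : ∀ i, m (e i : V) ∉ X := fun i => by simp [hmX]
  have hminj : ∀ a b, m a = m b ↔ a = b := fun a b =>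
    ⟨fun h => by rw [← hmm a, h, hmm], fun h => h ▸ rfl⟩
  have heinj : ∀ i j, (e i : V) = e j ↔ i = j := fun i j => by
    rw [← Subtype.ext_iff, e.injective.eq_iff]
  have hF : Function.Bijective F := by
    constructor
    · rintro (i | i) (j | j) h
      · rw [hFl, hFl, heinj] at h; rw [h]
      · rw [hFl, hFr] at h; exact absurd (h ▸ hmem i) (hmem' j)
      · rw [hFl, hFr] at h; exact absurd (h ▸ hmem j) (hmem' i)
      · rw [hFr, hFr, hminj, heinj] at h; rw [h]
    · intro v
      by_cases hv : v ∈ X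
      · exact ⟨Sum.inl (e.symm ⟨v, hv⟩), by simp [hFl]⟩
      · exact ⟨Sum.inr (e.symm ⟨m v, (hmX v).2 hv⟩), by simp [hFr, hmm]⟩
  have hcross : ∀ i j, B.Adj (e i) (m (e j)) ↔ i = j := fun i j => by
    rw [← heinj, ← hminj (e i), eq_comm, ← hm]
    exact ⟨fun h => ⟨h, by grind⟩, fun h => h.1⟩
  refine ⟨⟨Equiv.ofBijective F hF, ?_⟩, ?_⟩
  · rintro (i | i) (j | j) <;> simp only [Equiv.ofBijective_apply, hFl, hFr]
    · rw [starProd_adj_inl_inl, Ne, ← heinj i j]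
      exact ⟨fun h => h.ne, fun h => hcl (hmem i) (hmem j) h⟩
    · rw [starProd_adj_inl_inr, hcross]
    · rw [B.adj_comm, (starProd r r r).adj_comm, starProd_adj_inl_inr, hcross]
    · rw [starProd_adj_inr_inr, Ne, ← heinj i j, ← hminj]
      exact ⟨fun h => h.ne, fun h => hcl' (hmem' i) (hmem' j) h⟩
  · rintro (i | i)
    · have h1 : (e i : V) ≠ w' := fun h => hw' (h ▸ hmem i)
      have h2 : 1 ≤ (i : ℕ) ↔ i ≠ 0 := by rw [Nat.one_le_iff_ne_zero, Ne, Ne, Fin.val_eq_zero_iff]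
      simp [starWhisk, hFl, hew, h1, h2]
    · have h1 : m (e i : V) ≠ w := fun h => hmem' i (h ▸ hw)
      have h2 : 1 ≤ (i : ℕ) ↔ i ≠ 0 := by rw [Nat.one_le_iff_ne_zero, Ne, Ne, Fin.val_eq_zero_iff]
      simp [starWhisk, hFr, ← hmw, hminj, hew, h1, h2]

/-- let `B` be a connected non-complete graph with no cut vertex which
is `r`-regular and `r`-connected, and let `B̄` be obtained from `B` by attaching a
whisker at each vertex of some subset `S ⊆ V(B)`. If `B̄` is accessible, then `r ≥ 2`
and `B̄` is isomorphic to `overline(K_r ⋆ K_r)`. -/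
theorem accessible_regular_block_eq_star {V : Type u} [Fintype V] [DecidableEq V]
    (B : SimpleGraph V) (r : ℕ) (S : Set V)
    (hconn : B.Connected)
    (hnocut : ∀ x : V, ¬ CutVertexOn B Set.univ x)
    (hnoncomplete : ∃ a b : V, a ≠ b ∧ ¬ B.Adj a b)
    (hreg : ∀ x : V, (B.neighborSet x).ncard = r)
    (hrconn : ∀ T : Finset V, T.card < r → (B.induce ((↑T : Set V)ᶜ)).Connected)
    (hacc : AccessibleOn (whiskered B S) (Set.range Sum.inl ∪ Sum.inr '' S)) :
    2 ≤ r ∧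
      Nonempty
        (((whiskered B S).induce (Set.range Sum.inl ∪ Sum.inr '' S)) ≃g
          ((whiskered (starProd r r r) (starWhisk r r r)).induce
            (Set.range Sum.inl ∪ Sum.inr '' starWhisk r r r))) := by
  classical
  obtain ⟨hU, hA⟩ := hacc
  obtain ⟨a₀, b₀, hab₀, hnab₀⟩ := hnoncomplete
  have hN : ∀ v, ∃ w, ∀ x, (B.Adj v x ∧ x ∉ S) ↔ x = w := by
    intro v
    let T : Finset V := (B.neighborSet v).toFinset
    have hT : ∀ x, x ∈ T ↔ B.Adj v x := fun x => by simp [T]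
    have hTc : T.card = r := by rw [← hreg v, Set.ncard_eq_toFinset_card']
    have hr : T.Nonempty := by
      have : Nontrivial V := ⟨a₀, b₀, hab₀⟩
      obtain ⟨x, hx⟩ := hconn.preconnected.exists_adj_of_nontrivial v
      exact ⟨x, (hT x).2 hx⟩
    have hfar : ∃ u, u ≠ v ∧ ¬ B.Adj v u := by
      by_contra! hall
      have hv : {v}ᶜ ⊆ B.neighborSet v := fun x hx => hall x hx
      have ha : B.neighborSet a₀ ⊆ {a₀, b₀}ᶜ := by
        intro x hx
        simp only [Set.mem_compl_iff, Set.mem_insert_iff, Set.mem_singleton_iff]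
        rintro (rfl | rfl)
        · exact B.loopless.irrefl _ hx
        · exact hnab₀ hx
      have hv' := Set.ncard_le_ncard hv
      have ha' := Set.ncard_le_ncard ha
      have h1 := Set.ncard_add_ncard_compl {v}
      have h2 := Set.ncard_add_ncard_compl {a₀, b₀}
      rw [Set.ncard_pair hab₀] at h2
      rw [Set.ncard_singleton] at h1
      rw [hreg] at hv' ha'
      omega
    obtain ⟨u, huv, hvu⟩ := hfar
    have h2 : 2 ≤ cComp B (↑T)ᶜ := by
      refine le_cComp (fun x => if x = v then 0 else 1) ?_ ?_
      · intro i
        fin_cases i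
        · exact ⟨v, by simp [hT], by simp⟩
        · exact ⟨u, by simp [hT, hvu], by simp [huv]⟩
      · intro a ha b hb hab
        simp only [Set.mem_compl_iff, Finset.mem_coe, hT] at ha hb
        grind [B.adj_comm a b]
    have h1 : ∀ t ∈ T, cComp B (↑(T.erase t))ᶜ = 1 := fun t ht =>
      cComp_eq_one_of_connected (hrconn _ (hTc ▸ Finset.card_erase_lt_of_mem ht))
    have hcut := cutsetOn_whiskered (B := B) (S := S) (T := T) fun t ht => by
      have := Finset.card_le_card
        (Finset.filter_subset_filter (· ∈ S) (Finset.erase_subset t T))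
      have := h1 t ht
      omega
    have hTS := hU.cComp_add_card hconn hcut
    obtain ⟨t', ht', hcut'⟩ := hA _ hcut (hr.map)
    obtain ⟨t, ht, rfl⟩ := Finset.mem_map.1 ht'
    rw [← Finset.map_erase] at hcut'
    have hTS' := hU.cComp_add_card hconn hcut'
    rw [h1 t ht, Nat.add_comm, Nat.add_right_cancel_iff, Finset.card_filter_eq_iff] at hTS'
    have htS : t ∉ S := by
      intro htS
      have : T.filter (· ∈ S) = T := Finset.filter_true_of_mem fun x hx => by
        by_cases hxt : x = t
        · exact hxt ▸ htS
        · exact hTS' x (Finset.mem_erase.2 ⟨hxt, hx⟩)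
      rw [this] at hTS
      omega
    refine ⟨t, fun x => ⟨fun ⟨hx, hxS⟩ => ?_, ?_⟩⟩
    · by_contra hxt
      exact hxS (hTS' x (Finset.mem_erase.2 ⟨hxt, (hT x).2 hx⟩))
    · rintro rfl
      exact ⟨(hT x).1 ht, htS⟩
  choose m hm using hN
  have hmadj : ∀ v, B.Adj v (m v) := fun v => ((hm v _).2 rfl).1
  have hmS : ∀ v, m v ∉ S := fun v => ((hm v _).2 rfl).2
  have hsub : ∀ T : Finset V, (∀ t ∈ T, t ∈ S) → cComp B (↑T)ᶜ = 1 := by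
    intro T hT
    have hcut := cutsetOn_whiskered (B := B) (S := S) (T := T) fun t ht =>
      add_lt_add_of_le_of_lt
        (cComp_compl_erase_le (fun h => hmS t (hT _ h)) (hmadj t))
        (card_filter_erase_lt ht (hT t ht))
    have := hU.cComp_add_card hconn hcut
    rw [Finset.filter_true_of_mem hT] at this
    omega
  obtain ⟨w, w', hwS, hwS', hww, hmem⟩ :
      ∃ w w', w ∉ S ∧ w' ∉ S ∧ B.Adj w w' ∧ ∀ x, x ∉ S → x = w ∨ x = w' := by
    refine ⟨m a₀, m (m a₀), hmS _, hmS _, hmadj _, ?_⟩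
    by_contra! hx
    obtain ⟨x, hxS, hx1, hx2⟩ := hx
    have h1 := hsub (Finset.univ.filter (· ∈ S)) (by simp)
    have h2 : 2 ≤ cComp B (↑(Finset.univ.filter (· ∈ S)))ᶜ := by
      refine le_cComp (fun x => if x = m a₀ ∨ x = m (m a₀) then 0 else 1) ?_ ?_
      · intro i
        fin_cases i
        · exact ⟨m a₀, by simp [hmS], by simp⟩
        · exact ⟨x, by simp [hxS], by simp [hx1, hx2]⟩
      · intro a ha b hb hab
        simp only [Finset.coe_filter, Finset.mem_univ, true_and, Set.mem_compl_iff,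
          Set.mem_ofPred_eq] at ha hb
        have e1 := hm a b
        have e2 := hm b a
        have e3 := hm (m a₀) (m (m a₀))
        have e4 := hm (m (m a₀)) (m a₀)
        have e5 := hmadj (m a₀)
        have e6 := hmS a₀
        have e7 := B.adj_comm a b
        have e8 := B.adj_comm (m a₀) (m (m a₀))
        grind
    omega
  have hone : ∀ x, B.Adj w x ↔ ¬ B.Adj w' x := by
    intro x
    have h1 := hmem _ (hmS x)
    have h2 := hmadj x
    have h3 := hm x w
    have h4 := hm x w'
    have h5 := hww.ne
    have h6 := B.adj_comm x w
    have h7 := B.adj_comm x w'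
    grind
  have hclique : ∀ w w', w ∉ S → w' ∉ S → B.Adj w w' → (∀ x, x ∉ S → x = w ∨ x = w') →
      (∀ x, B.Adj w x ↔ ¬ B.Adj w' x) →
      B.IsClique {x | x = w ∨ (B.Adj w x ∧ x ≠ w')} := by
    clear! w w'
    intro w w' hwS hwS' hww hmem hone
    have hpair : ∀ a b, B.Adj w a → B.Adj w b → a ≠ w' → b ≠ w' → a ≠ b → B.Adj a b := by
      intro a b ha hb haw hbw hab
      by_contra hnab
      let T' : Finset V := Finset.univ.filter fun x => x ∈ S ∧ (B.Adj w' x ∨ B.Adj a x)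
      have hT' : ∀ x, x ∈ T' ↔ x ∈ S ∧ (B.Adj w' x ∨ B.Adj a x) := by simp [T']
      have hwT' : w ∉ T' := fun h => hwS ((hT' w).1 h).1
      have hT : ∀ x, x ∈ insert w T' ↔ x = w ∨ (x ∈ S ∧ (B.Adj w' x ∨ B.Adj a x)) := fun x => by
        rw [Finset.mem_insert, hT']
      have ha' := (hone a).1 ha
      have hb' := (hone b).1 hb
      have hwT : w' ∉ insert w T' := by
        rw [hT]
        rintro (h | h)
        · exact hww.ne h.symm
        · exact hwS' h.1
      have haT : a ∉ insert w T' := by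
        rw [hT]
        rintro (h | h)
        · exact ha.ne h.symm
        · exact h.2.elim ha' (B.loopless.irrefl a)
      have hbT : b ∉ insert w T' := by
        rw [hT]
        rintro (h | h)
        · exact hb.ne h.symm
        · exact h.2.elim hb' hnab
      have h1 := hsub T' fun x hx => ((hT' x).1 hx).1
      have h3 : 3 ≤ cComp B (↑(insert w T'))ᶜ := by
        refine le_cComp (fun x => if x = w' then 0 else if x = a then 1 else 2) ?_ ?_
        · intro i
          fin_cases i
          · exact ⟨w', by simpa only [Set.mem_compl_iff, Finset.mem_coe] using hwT, by simp⟩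
          · exact ⟨a, by simpa only [Set.mem_compl_iff, Finset.mem_coe] using haT, by simp [haw]⟩
          · exact ⟨b, by simpa only [Set.mem_compl_iff, Finset.mem_coe] using hbT,
              by simp [hbw, Ne.symm hab]⟩
        · intro x hx y hy hxy
          simp only [Set.mem_compl_iff, Finset.mem_coe, hT] at hx hy
          have e1 := B.adj_comm x y
          have e2 := B.adj_comm w' a
          have e3 := hmem x
          have e4 := hmem y
          grind
      have hcut := cutsetOn_whiskered (B := B) (S := S) (T := insert w T') fun t ht => by
        rcases Finset.mem_insert.1 ht with rfl | ht'
        · rw [Finset.erase_insert hwT', Finset.filter_insert, if_neg hwS]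
          omega
        · obtain ⟨htS, htadj⟩ := (hT' t).1 ht'
          refine add_lt_add_of_le_of_lt ?_ (card_filter_erase_lt ht htS)
          rcases htadj with h | h
          · exact cComp_compl_erase_le hwT h.symm
          · exact cComp_compl_erase_le haT h.symm
      have := hU.cComp_add_card hconn hcut
      rw [Finset.card_insert_of_notMem hwT', Finset.filter_insert, if_neg hwS,
        Finset.filter_true_of_mem fun x hx => ((hT' x).1 hx).1] at this
      omega
    rintro a (rfl | ⟨ha, ha'⟩) b (rfl | ⟨hb, hb'⟩) hab
    · exact absurd rfl hab
    · exact hb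
    · exact ha.symm
    · exact hpair a b ha hb ha' hb' hab
  have hcard : ∀ w w', B.Adj w w' → {x | x = w ∨ (B.Adj w x ∧ x ≠ w')}.ncard = r := by
    intro w w' h
    have e : {x | x = w ∨ (B.Adj w x ∧ x ≠ w')} = insert w (B.neighborSet w \ {w'}) := by
      ext x
      simp
    rw [e, Set.ncard_insert_of_notMem (by simp),
      Set.ncard_sdiff_singleton_add_one (by simpa using h), hreg]
  have hone' : ∀ x, B.Adj w' x ↔ ¬ B.Adj w x := fun x => by rw [hone, not_not]
  have hcompl : {x | x = w ∨ (B.Adj w x ∧ x ≠ w')}ᶜ = {x | x = w' ∨ (B.Adj w' x ∧ x ≠ w)} := by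
    ext x
    simp only [Set.mem_compl_iff, Set.mem_ofPred_eq, hone']
    have := hww.ne
    grind
  have hX := hcard w w' hww
  have hX' := hcompl ▸ hcard w' w hww.symm
  refine ⟨?_, ?_⟩
  · by_contra! hr
    have h1 := (Set.ncard_le_one (Set.toFinite _)).1 (show {x | x = w ∨ (B.Adj w x ∧ x ≠ w')}.ncard ≤ 1 by
      omega)
    have h2 := (Set.ncard_le_one (Set.toFinite _)).1 (show {x | x = w' ∨ (B.Adj w' x ∧ x ≠ w)}.ncard ≤ 1 by
      rw [hcard w' w hww.symm]; omega)
    have h3 : ∀ x, x = w ∨ x = w' := fun x => by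
      by_contra! hx
      by_cases h : B.Adj w x
      · exact hx.1 (h1 x (Or.inr ⟨h, hx.2⟩) w (Or.inl rfl))
      · exact hx.2 (h2 x (Or.inr ⟨(hone' x).2 h, hx.1⟩) w' (Or.inl rfl))
    rcases h3 a₀ with rfl | rfl <;> rcases h3 b₀ with rfl | rfl
    · exact hab₀ rfl
    · exact hnab₀ hww
    · exact hnab₀ hww.symm
    · exact hab₀ rfl
  · obtain ⟨φ, hφ⟩ := exists_iso_starProd hreg hX hX' (hclique w w' hwS hwS' hww hmem hone)
      (hcompl ▸ hclique w' w hwS' hwS hww.symm (fun x hx => (hmem x hx).symm) hone')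
      (Or.inl rfl) (fun h => h.elim (fun h => hww.ne h.symm) fun h => h.2 rfl) hww
    refine whiskered_induce_iso φ.symm fun x => ?_
    rw [hφ, φ.apply_symm_apply]
    refine ⟨fun h => ?_, fun h => ⟨?_, ?_⟩⟩
    · by_contra hx
      exact (hmem x hx).elim h.1 h.2
    · rintro rfl
      exact hwS h
    · rintro rfl
      exact hwS' h
end
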